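/- arXiv:2005.12223 — 3 statements merged into one kernel-verified Lean document; each statement's English description precedes it below -/
import Mathlib

section
/- Let 0 ≠ ν < 1, 1 ≤ p < ∞, δ ∈ ℝ. The exotic Bessel heat semigroup maximal operator W̃_*^ν, considered on the measure space (ℝ₊, x^δ dx), is of restricted weak type (p,p) if and only if 2νp − 1 ≤ δ ≤ 2p − 1. -/
open MeasureTheory Set ENNReal
open scoped NNReal

noncomputable section

/-- The measure `x^δ dx` on `(0,∞)`. -/
def powMeasure (δ : ℝ) : Measure ℝ :=
  (volume.restrict (Ioi (0:ℝ))).withDensity (fun x => ENNReal.ofReal (x ^ δ))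

/-- `f ∈ L^p(ℝ₊, x^δ dx)` for a real exponent `p`. -/
def MemLpPow (f : ℝ → ℝ) (p δ : ℝ) : Prop :=
  AEMeasurable f (powMeasure δ) ∧
    ∫⁻ x, ENNReal.ofReal |f x| ^ p ∂(powMeasure δ) < ⊤

/-- `T` is of strong type `(p,p)` with respect to `(ℝ₊, x^δ dx)`. -/
def IsStrongType (T : (ℝ → ℝ) → (ℝ → ℝ)) (p δ : ℝ) : Prop :=
  ∃ C : ℝ≥0, ∀ f : ℝ → ℝ, MemLpPow f p δ →
    ∫⁻ x, ENNReal.ofReal |T f x| ^ p ∂(powMeasure δ) ≤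
      C * ∫⁻ x, ENNReal.ofReal |f x| ^ p ∂(powMeasure δ)

/-- `T` is of strong type `(∞,∞)`, i.e. bounded on `L^∞(ℝ₊, dx)`. -/
def IsStrongTypeInfty (T : (ℝ → ℝ) → (ℝ → ℝ)) : Prop :=
  ∃ C : ℝ≥0, ∀ f : ℝ → ℝ,
    eLpNorm (T f) ⊤ (volume.restrict (Ioi (0:ℝ))) ≤
      C * eLpNorm f ⊤ (volume.restrict (Ioi (0:ℝ)))

/-- `T` is of weak type `(p,p)` with respect to `(ℝ₊, x^δ dx)`. -/
def IsWeakType (T : (ℝ → ℝ) → (ℝ → ℝ)) (p δ : ℝ) : Prop :=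
  ∃ C : ℝ≥0, ∀ f : ℝ → ℝ, MemLpPow f p δ → ∀ l : ℝ, 0 < l →
    ENNReal.ofReal (l ^ p) * powMeasure δ {y | l < |T f y|} ≤
      C * ∫⁻ x, ENNReal.ofReal |f x| ^ p ∂(powMeasure δ)

/-- `T` is of restricted weak type `(p,p)` with respect to `(ℝ₊, x^δ dx)`:
the weak type inequality holds uniformly over indicator functions of sets of
finite `x^δ dx` measure. -/
def IsRestrictedWeakType (T : (ℝ → ℝ) → (ℝ → ℝ)) (p δ : ℝ) : Prop :=
  ∃ C : ℝ≥0, ∀ E : Set ℝ, MeasurableSet E → powMeasure δ E < ⊤ → ∀ l : ℝ, 0 < l →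
    ENNReal.ofReal (l ^ p) * powMeasure δ {y | l < |T (E.indicator 1) y|} ≤
      C * powMeasure δ E

/-- The modified Bessel function `I_μ` (for `μ > -1`, `w > 0`). -/
def besselI (μ : ℝ) (w : ℝ) : ℝ :=
  ∑' n : ℕ, (w / 2) ^ (2 * (n : ℝ) + μ) / (Real.Gamma ((n : ℝ) + 1) * Real.Gamma ((n : ℝ) + μ + 1))

/-- The classical Bessel heat kernel `W_t^ν(x,y)` (for `ν > -1`). -/
def Wcls (ν t x y : ℝ) : ℝ :=
  (2 * t)⁻¹ * (x * y) ^ (-ν) * Real.exp (-(x ^ 2 + y ^ 2) / (4 * t)) * besselI ν (x * y / (2 * t))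

/-- The exotic Bessel heat kernel `W̃_t^ν(x,y)` (for `ν < 1`). -/
def Wexo (ν t x y : ℝ) : ℝ :=
  (x * y) ^ (-(2 * ν)) * Wcls (-ν) t x y

/-- The measure `dη_ν(x) = x^{2ν+1} dx` on `(0,∞)`. -/
def etaMeasure (ν : ℝ) : Measure ℝ :=
  (volume.restrict (Ioi (0:ℝ))).withDensity (fun x => ENNReal.ofReal (x ^ (2 * ν + 1)))

/-- `W̃_t^ν f(x) = ∫₀^∞ W̃_t^ν(x,y) f(y) dη_ν(y)`. -/
def WexoInt (ν t : ℝ) (f : ℝ → ℝ) (x : ℝ) : ℝ :=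
  ∫ y, Wexo ν t x y * f y ∂(etaMeasure ν)

/-- The exotic Bessel heat semigroup maximal operator `W̃_*^ν`. -/
def WexoMax (ν : ℝ) (f : ℝ → ℝ) (x : ℝ) : ℝ≥0∞ :=
  ⨆ t ∈ Ioi (0:ℝ), ENNReal.ofReal |WexoInt ν t f x|


section Bessel

lemma inv_Gamma_mul_Gamma_le_of_half_le_abs {μ : ℝ} (hμ : -1 < μ) (h : 1 / 2 ≤ |μ|) (n : ℕ) :
    1 / (Real.Gamma (n + 1) * Real.Gamma (n + μ + 1)) ≤
      2 * 2 ^ (2 * (n : ℝ) + μ) / Real.Gamma (2 * n + μ + 3 / 2) := by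
  have hn : (0 : ℝ) ≤ n := n.cast_nonneg
  have hA : (0 : ℝ) < n + 1 := by linarith
  have hB : (0 : ℝ) < n + μ + 1 := by linarith
  have hs : (0 : ℝ) < n + μ / 2 + 3 / 4 := by linarith
  have hμ0 : μ ≠ 0 := by rintro rfl; norm_num at h
  have hle : |1 / (4 * μ)| ≤ 1 / 2 := by
    rw [abs_div, abs_mul, abs_one, abs_of_pos (by norm_num : (0 : ℝ) < 4),
      div_le_iff₀ (by positivity)]
    linarith
  obtain ⟨h1, h2⟩ := abs_le.1 hle
  set a : ℝ := 1 / 2 + 1 / (4 * μ) with ha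
  set b : ℝ := 1 / 2 - 1 / (4 * μ) with hb
  have hab : a + b = 1 := by simp [ha, hb]; norm_num
  have conv := Real.convexOn_log_Gamma.2
  have c1 := conv (x := (n : ℝ) + 1) hA (y := n + μ + 1) hB (a := a) (b := b)
    (by linarith) (by linarith) hab
  have c2 := conv (x := (n : ℝ) + 1) hA (y := n + μ + 1) hB (a := b) (b := a)
    (by linarith) (by linarith) (by linarith)
  have e1 : a • ((n : ℝ) + 1) + b • ((n : ℝ) + μ + 1) = n + μ / 2 + 3 / 4 := by
    simp only [smul_eq_mul, ha, hb]; field_simp; ring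
  have e2 : b • ((n : ℝ) + 1) + a • ((n : ℝ) + μ + 1) = n + μ / 2 + 3 / 4 + 1 / 2 := by
    simp only [smul_eq_mul, ha, hb]; field_simp; ring
  rw [e1] at c1
  rw [e2] at c2
  simp only [Function.comp_apply, smul_eq_mul] at c1 c2
  have key : Real.log (Real.Gamma (n + μ / 2 + 3 / 4) * Real.Gamma (n + μ / 2 + 3 / 4 + 1 / 2)) ≤
      Real.log (Real.Gamma (n + 1) * Real.Gamma (n + μ + 1)) := by
    rw [Real.log_mul (Real.Gamma_pos_of_pos hs).ne'
      (Real.Gamma_pos_of_pos (by linarith)).ne', Real.log_mul (Real.Gamma_pos_of_pos hA).ne'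
      (Real.Gamma_pos_of_pos hB).ne']
    have : b = 1 - a := by linarith
    rw [this] at c1 c2
    linarith
  have pA := Real.Gamma_pos_of_pos hA
  have pB := Real.Gamma_pos_of_pos hB
  have p1 := Real.Gamma_pos_of_pos hs
  have p2 : 0 < Real.Gamma (n + μ / 2 + 3 / 4 + 1 / 2) := Real.Gamma_pos_of_pos (by linarith)
  have p3 : 0 < Real.Gamma (2 * n + μ + 3 / 2) := Real.Gamma_pos_of_pos (by linarith)
  have key' := (Real.log_le_log_iff (by positivity) (by positivity)).1 key
  rw [Real.Gamma_mul_Gamma_add_half, show 2 * ((n : ℝ) + μ / 2 + 3 / 4) = 2 * n + μ + 3 / 2 by ring]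
    at key'
  have hπ : 1 ≤ √Real.pi := Real.one_le_sqrt.2 (by linarith [Real.pi_gt_three])
  rw [div_le_div_iff₀ (by positivity) p3]
  have hpow : (2 : ℝ) ^ (1 - (2 * (n : ℝ) + μ + 3 / 2)) * (2 * 2 ^ (2 * (n : ℝ) + μ)) = 2 ^ (1 / 2 : ℝ) := by
    rw [mul_left_comm, ← Real.rpow_add two_pos, ← Real.rpow_one_add' two_pos.le (by ring_nf; norm_num)]
    congr 1; ring
  have hone : (1 : ℝ) ≤ 2 ^ (1 / 2 : ℝ) := Real.one_le_rpow (by norm_num) (by norm_num)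
  calc 1 * Real.Gamma (2 * n + μ + 3 / 2)
      ≤ (2 ^ (1 / 2 : ℝ) * √Real.pi) * Real.Gamma (2 * n + μ + 3 / 2) := by
        gcongr; nlinarith
    _ = 2 * 2 ^ (2 * (n : ℝ) + μ) * (Real.Gamma (2 * n + μ + 3 / 2) *
          2 ^ (1 - (2 * (n : ℝ) + μ + 3 / 2)) * √Real.pi) := by rw [← hpow]; ring
    _ ≤ _ := by gcongr

lemma inv_Gamma_mul_Gamma_le {μ : ℝ} (hμ : -1 < μ) (n : ℕ) :
    1 / (Real.Gamma (n + 1) * Real.Gamma (n + μ + 1)) ≤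
      8 * 2 ^ (2 * (n : ℝ) + μ) / Real.Gamma (2 * n + μ + 3 / 2) := by
  have hn : (0 : ℝ) ≤ n := n.cast_nonneg
  have p3 : 0 < Real.Gamma (2 * n + μ + 3 / 2) := Real.Gamma_pos_of_pos (by linarith)
  have pA : 0 < Real.Gamma ((n : ℝ) + 1) := Real.Gamma_pos_of_pos (by linarith)
  have pB : 0 < Real.Gamma ((n : ℝ) + μ + 1) := Real.Gamma_pos_of_pos (by linarith)
  rcases le_or_gt μ (-(1 / 2)) with h | h
  · refine (inv_Gamma_mul_Gamma_le_of_half_le_abs hμ ?_ n).trans ?_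
    · rw [abs_of_nonpos (by linarith)]; linarith
    · gcongr; norm_num
  · have := inv_Gamma_mul_Gamma_le_of_half_le_abs (μ := μ + 1) (by linarith)
      (by rw [abs_of_nonneg (by linarith)]; linarith) n
    rw [show (n : ℝ) + (μ + 1) + 1 = (n + μ + 1) + 1 by ring,
      Real.Gamma_add_one (by linarith : (n : ℝ) + μ + 1 ≠ 0),
      show 2 * (n : ℝ) + (μ + 1) + 3 / 2 = (2 * n + μ + 3 / 2) + 1 by ring,
      Real.Gamma_add_one (by linarith : 2 * (n : ℝ) + μ + 3 / 2 ≠ 0),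
      ← add_assoc, Real.rpow_add_one two_ne_zero] at this
    have q1 : (0 : ℝ) < n + μ + 1 := by linarith
    have q2 : (0 : ℝ) < 2 * n + μ + 3 / 2 := by linarith
    calc 1 / (Real.Gamma (n + 1) * Real.Gamma (n + μ + 1))
        = (n + μ + 1) * (1 / (Real.Gamma (n + 1) * ((n + μ + 1) * Real.Gamma (n + μ + 1)))) := by
          field_simp
      _ ≤ (n + μ + 1) * (2 * (2 ^ (2 * (n : ℝ) + μ) * 2) /
            ((2 * n + μ + 3 / 2) * Real.Gamma (2 * n + μ + 3 / 2))) := by gcongr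
      _ = ((n + μ + 1) / (2 * n + μ + 3 / 2)) *
            (4 * 2 ^ (2 * (n : ℝ) + μ) / Real.Gamma (2 * n + μ + 3 / 2)) := by
          field_simp; norm_num
      _ ≤ 2 * (4 * 2 ^ (2 * (n : ℝ) + μ) / Real.Gamma (2 * n + μ + 3 / 2)) := by
          gcongr
          rw [div_le_iff₀ q2]; linarith
      _ = _ := by ring

lemma factorial_mul_rpow_le_Gamma {m : ℕ} (hm : 1 ≤ m) {θ : ℝ} (h0 : 0 ≤ θ) :
    (m.factorial : ℝ) * (m : ℝ) ^ θ ≤ Real.Gamma (m + θ + 1) := by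
  have hm' : (0 : ℝ) < m := by exact_mod_cast hm
  rcases h0.eq_or_lt with rfl | hθ
  · simp [Real.Gamma_nat_eq_factorial]
  · have := Real.BohrMollerup.f_add_nat_ge (f := Real.log ∘ Real.Gamma) (n := m + 1) (x := θ)
      Real.convexOn_log_Gamma ?_ (by omega) hθ
    · simp only [Function.comp_apply] at this
      push_cast at this
      rw [add_sub_cancel_right, Real.Gamma_nat_eq_factorial, ← Real.log_rpow hm',
        ← Real.log_mul (by positivity) (by positivity)] at this
      rw [show (m : ℝ) + θ + 1 = m + 1 + θ by ring]
      exact (Real.log_le_log_iff (by positivity) (Real.Gamma_pos_of_pos (by positivity))).1 this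
    · intro y hy
      simp only [Function.comp_apply]
      rw [Real.Gamma_add_one hy.ne', Real.log_mul hy.ne' (Real.Gamma_pos_of_pos hy).ne', add_comm]

lemma rpow_div_Gamma_le {x w : ℝ} (hx : 1 ≤ x) (hw : 0 < w) :
    w ^ x / Real.Gamma (x + 1) ≤
      w ^ ⌊x⌋₊ / (⌊x⌋₊).factorial + 2 * (w ^ (⌊x⌋₊ + 1) / (⌊x⌋₊ + 1).factorial) := by
  set m := ⌊x⌋₊ with hm
  have hm1 : 1 ≤ m := Nat.le_floor (by simpa using hx)
  have hm' : (1 : ℝ) ≤ m := by exact_mod_cast hm1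
  have hmx : (m : ℝ) ≤ x := Nat.floor_le (by linarith)
  have hmx' : x < m + 1 := Nat.lt_floor_add_one x
  have hG := factorial_mul_rpow_le_Gamma hm1 (θ := x - m) (by linarith)
  rw [add_sub_cancel] at hG
  have hθ : (w / m) ^ (x - m) ≤ 1 + w / m := by
    rcases le_total (w / m) 1 with h | h
    · have := Real.rpow_le_one (by positivity) h (by linarith : 0 ≤ x - m)
      have : 0 < w / m := by positivity
      linarith
    · have := Real.rpow_le_rpow_of_exponent_le h (by linarith : x - m ≤ 1)
      rw [Real.rpow_one] at this
      linarith
  calc w ^ x / Real.Gamma (x + 1) ≤ w ^ x / (m.factorial * (m : ℝ) ^ (x - m)) := by gcongr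
    _ = w ^ m / m.factorial * (w / m) ^ (x - m) := by
        rw [Real.div_rpow hw.le (by positivity)]
        nth_rewrite 1 [show x = m + (x - m) by ring]
        rw [Real.rpow_add hw, Real.rpow_natCast]
        field_simp
    _ ≤ w ^ m / m.factorial * (1 + w / m) := by gcongr
    _ = w ^ m / m.factorial + w ^ (m + 1) / (m.factorial * m) := by
        field_simp; ring
    _ ≤ _ := by
        gcongr
        rw [Nat.factorial_succ, ← mul_div_assoc, div_le_div_iff₀ (by positivity) (by positivity)]
        push_cast
        have : (0 : ℝ) < w ^ (m + 1) * m.factorial := by positivity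
        nlinarith

lemma besselI_term_nonneg {μ : ℝ} (hμ : -1 < μ) {w : ℝ} (hw : 0 < w) (n : ℕ) :
    0 ≤ (w / 2) ^ (2 * (n : ℝ) + μ) /
      (Real.Gamma ((n : ℝ) + 1) * Real.Gamma ((n : ℝ) + μ + 1)) := by
  have hn : (0 : ℝ) ≤ n := n.cast_nonneg
  have pA : 0 < Real.Gamma ((n : ℝ) + 1) := Real.Gamma_pos_of_pos (by linarith)
  have pB : 0 < Real.Gamma ((n : ℝ) + μ + 1) := Real.Gamma_pos_of_pos (by linarith)
  positivity

lemma besselI_term_le {μ : ℝ} (hμ : -1 < μ) {w : ℝ} (hw : 0 < w) (n : ℕ) :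
    (w / 2) ^ (2 * (n : ℝ) + μ) / (Real.Gamma ((n : ℝ) + 1) * Real.Gamma ((n : ℝ) + μ + 1)) ≤
      8 * w ^ (-(1 / 2) : ℝ) * (w ^ (2 * (n : ℝ) + μ + 1 / 2) /
        Real.Gamma (2 * n + μ + 1 / 2 + 1)) := by
  have := mul_le_mul_of_nonneg_left (inv_Gamma_mul_Gamma_le hμ n)
    (by positivity : 0 ≤ (w / 2) ^ (2 * (n : ℝ) + μ))
  rw [mul_one_div] at this
  refine this.trans_eq ?_
  rw [Real.div_rpow hw.le two_pos.le, show 2 * (n : ℝ) + μ + 3 / 2 = 2 * n + μ + 1 / 2 + 1 by ring,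
    Real.rpow_add hw (2 * (n : ℝ) + μ) (1 / 2), Real.rpow_neg hw.le]
  field_simp

lemma hasSum_pow_div_factorial (w : ℝ) :
    HasSum (fun n : ℕ => w ^ n / n.factorial) (Real.exp w) := by
  rw [Real.exp_eq_exp_ℝ]; exact NormedSpace.expSeries_div_hasSum_exp w

lemma summable_besselI_and_le {μ : ℝ} (hμ : -1 < μ) {w : ℝ} (hw : 0 < w) :
    Summable (fun n : ℕ => (w / 2) ^ (2 * (n : ℝ) + μ) /
      (Real.Gamma ((n : ℝ) + 1) * Real.Gamma ((n : ℝ) + μ + 1))) ∧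
    besselI μ w ≤ 8 * w ^ (-(1 / 2) : ℝ) *
      (w ^ (μ + 1 / 2) / Real.Gamma (μ + 1 / 2 + 1) + 3 * Real.exp w) := by
  set f : ℕ → ℝ := fun n : ℕ => (w / 2) ^ (2 * (n : ℝ) + μ) /
      (Real.Gamma ((n : ℝ) + 1) * Real.Gamma ((n : ℝ) + μ + 1)) with hf
  set k : ℕ := ⌊2 + (μ + 1 / 2)⌋₊ with hk
  set e : ℕ → ℝ := fun n => w ^ n / n.factorial with he
  have hes : HasSum e (Real.exp w) := hasSum_pow_div_factorial w
  have he0 : ∀ n, 0 ≤ e n := fun n => by positivity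
  have i1 : Function.Injective (fun n : ℕ => 2 * n + k) := fun a b h => by
    simp only at h; omega
  have i2 : Function.Injective (fun n : ℕ => 2 * n + k + 1) := fun a b h => by
    simp only at h; omega
  have s1 := hes.summable.comp_injective i1
  have s2 := hes.summable.comp_injective i2
  have l1 := _root_.tsum_comp_le_tsum_of_inj hes.summable he0 i1
  have l2 := _root_.tsum_comp_le_tsum_of_inj hes.summable he0 i2
  rw [hes.tsum_eq] at l1 l2
  have hgs := ((s1.hasSum.add (s2.hasSum.mul_left 2)).mul_left (8 * w ^ (-(1 / 2) : ℝ)))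
  have hle : ∀ n, f (n + 1) ≤ 8 * w ^ (-(1 / 2) : ℝ) *
      ((e ∘ fun n : ℕ => 2 * n + k) n + 2 * (e ∘ fun n : ℕ => 2 * n + k + 1) n) := by
    intro n
    refine (besselI_term_le hμ hw (n + 1)).trans ?_
    have hfl : ⌊2 * ((n + 1 : ℕ) : ℝ) + μ + 1 / 2⌋₊ = 2 * n + k := by
      rw [show 2 * ((n + 1 : ℕ) : ℝ) + μ + 1 / 2 = (2 + (μ + 1 / 2)) + (2 * n : ℕ) by
        push_cast; ring, Nat.floor_add_natCast (by linarith), add_comm]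
    have hn : (0 : ℝ) ≤ n := n.cast_nonneg
    have := rpow_div_Gamma_le (x := 2 * ((n + 1 : ℕ) : ℝ) + μ + 1 / 2)
      (by push_cast; linarith) hw
    rw [hfl] at this
    gcongr
    exact this
  have hs' : Summable fun n => f (n + 1) :=
    Summable.of_nonneg_of_le (fun n => besselI_term_nonneg hμ hw _) hle hgs.summable
  have hs : Summable f := (summable_nat_add_iff 1).1 hs'
  refine ⟨hs, ?_⟩
  have : besselI μ w = f 0 + ∑' n, f (n + 1) := hs.tsum_eq_zero_add
  rw [this, mul_add]
  refine add_le_add ?_ ?_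
  · have := besselI_term_le hμ hw 0
    simpa [f] using this
  · refine (Summable.tsum_le_tsum hle hs' hgs.summable).trans ?_
    rw [hgs.tsum_eq]
    gcongr
    linarith

lemma rpow_le_const_mul_exp {a : ℝ} : ∃ C : ℝ, 0 < C ∧ ∀ w : ℝ, 0 < w → w ^ a ≤ C * Real.exp w ∨ w < 1 := by
  set k := ⌈a⌉₊
  refine ⟨k.factorial, by positivity, fun w hw => ?_⟩
  rcases lt_or_ge w 1 with h | h
  · exact Or.inr h
  · left
    have h1 : w ^ a ≤ w ^ k := by
      rw [← Real.rpow_natCast]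
      exact Real.rpow_le_rpow_of_exponent_le h (Nat.le_ceil a)
    have h2 := Real.pow_div_factorial_le_exp w hw.le k
    rw [div_le_iff₀ (by positivity)] at h2
    linarith

/-- The large-argument bound for `I_μ`. -/
lemma exists_besselI_le_of_one_le {μ : ℝ} (hμ : -1 < μ) :
    ∃ C : ℝ, 0 < C ∧ ∀ w : ℝ, 1 ≤ w → besselI μ w ≤ C * (w ^ (-(1 / 2) : ℝ) * Real.exp w) := by
  obtain ⟨C, hC, h⟩ := rpow_le_const_mul_exp (a := μ + 1 / 2)
  have hG : 0 < Real.Gamma (μ + 1 / 2 + 1) := Real.Gamma_pos_of_pos (by linarith)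
  refine ⟨8 * (C / Real.Gamma (μ + 1 / 2 + 1) + 3), by positivity, fun w hw => ?_⟩
  have hw0 : 0 < w := by linarith
  refine (summable_besselI_and_le hμ hw0).2.trans ?_
  have h1 := (h w hw0).resolve_right (by linarith)
  calc _ ≤ 8 * w ^ (-(1 / 2) : ℝ) *
      (C * Real.exp w / Real.Gamma (μ + 1 / 2 + 1) + 3 * Real.exp w) := by gcongr
    _ = _ := by ring

lemma besselI_nonneg {μ : ℝ} (hμ : -1 < μ) {w : ℝ} (hw : 0 < w) : 0 ≤ besselI μ w :=
  tsum_nonneg (besselI_term_nonneg hμ hw)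

/-- The small-argument bound for `I_μ`. -/
lemma besselI_le_of_le_one {μ : ℝ} (hμ : -1 < μ) {w : ℝ} (hw : 0 < w) (hw1 : w ≤ 1) :
    besselI μ w ≤ w ^ μ * besselI μ 1 := by
  unfold besselI
  rw [← tsum_mul_left]
  refine Summable.tsum_le_tsum (fun n => ?_) (summable_besselI_and_le hμ hw).1
    ((summable_besselI_and_le hμ one_pos).1.mul_left _)
  have hn : (0 : ℝ) ≤ n := n.cast_nonneg
  have pA : 0 < Real.Gamma ((n : ℝ) + 1) := Real.Gamma_pos_of_pos (by linarith)
  have pB : 0 < Real.Gamma ((n : ℝ) + μ + 1) := Real.Gamma_pos_of_pos (by linarith)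
  rw [← mul_div_assoc]
  refine div_le_div_of_nonneg_right ?_ (by positivity)
  rw [Real.div_rpow hw.le two_pos.le, Real.div_rpow one_pos.le two_pos.le, Real.one_rpow,
    mul_one_div]
  refine div_le_div_of_nonneg_right ?_ (by positivity)
  rw [Real.rpow_add hw]
  have : w ^ (2 * (n : ℝ)) ≤ 1 := Real.rpow_le_one hw.le hw1 (by linarith)
  have h0 : 0 < w ^ μ := by positivity
  nlinarith

/-- The leading term is a lower bound for `I_μ`. -/
lemma le_besselI {μ : ℝ} (hμ : -1 < μ) {w : ℝ} (hw : 0 < w) :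
    (w / 2) ^ μ / Real.Gamma (μ + 1) ≤ besselI μ w := by
  have := (summable_besselI_and_le hμ hw).1.le_tsum 0
    (fun n _ => besselI_term_nonneg hμ hw n)
  simpa [besselI] using this

end Bessel

section Kernel

lemma exists_rpow_le_const_mul_exp {a : ℝ} (ha : 0 ≤ a) :
    ∃ C : ℝ, 0 < C ∧ ∀ w : ℝ, 0 < w → Real.exp (-w) ≤ C * w ^ (-a) := by
  obtain ⟨C, hC, h⟩ := rpow_le_const_mul_exp (a := a)
  refine ⟨C + 1, by positivity, fun w hw => ?_⟩
  rw [Real.exp_neg, Real.rpow_neg hw.le, ← div_eq_mul_inv, inv_eq_one_div,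
    div_le_div_iff₀ (Real.exp_pos w) (by positivity), one_mul]
  rcases h w hw with h | h
  · nlinarith [Real.exp_pos w]
  · nlinarith [Real.rpow_le_one hw.le h.le ha, Real.one_le_exp hw.le, Real.exp_pos w]

lemma rpow_le_two_rpow_abs {r : ℝ} (h1 : 1 / 2 ≤ r) (h2 : r ≤ 2) (a : ℝ) : r ^ a ≤ 2 ^ |a| := by
  rcases le_total 0 a with h | h
  · rw [abs_of_nonneg h]; exact Real.rpow_le_rpow (by linarith) h2 h
  · rw [abs_of_nonpos h, Real.rpow_neg two_pos.le, ← Real.inv_rpow two_pos.le]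
    exact Real.rpow_le_rpow_of_nonpos (by norm_num) (by linarith) h

lemma Wexo_mul_rpow (ν : ℝ) {t x y : ℝ} (hx : 0 < x) (hy : 0 < y) :
    Wexo ν t x y * y ^ (2 * ν + 1) = x ^ (-(2 * ν)) * (2 * t)⁻¹ * (x * y) ^ ν * y *
      Real.exp (-(x ^ 2 + y ^ 2) / (4 * t)) * besselI (-ν) (x * y / (2 * t)) := by
  have : (x * y) ^ (-(2 * ν)) * y ^ (2 * ν + 1) = x ^ (-(2 * ν)) * y := by
    rw [Real.mul_rpow hx.le hy.le, mul_assoc, ← Real.rpow_add hy]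
    simp
  unfold Wexo Wcls
  rw [neg_neg]
  linear_combination ((2 * t)⁻¹ * (x * y) ^ ν * Real.exp (-(x ^ 2 + y ^ 2) / (4 * t)) *
    besselI (-ν) (x * y / (2 * t))) * this

lemma Wexo_nonneg {ν : ℝ} (hν : ν < 1) {t x y : ℝ} (ht : 0 < t) (hx : 0 < x) (hy : 0 < y) :
    0 ≤ Wexo ν t x y := by
  have := besselI_nonneg (μ := -ν) (by linarith) (by positivity : 0 < x * y / (2 * t))
  unfold Wexo Wcls
  positivity

lemma exists_Wexo_le_of_le {ν : ℝ} (hν : ν < 1) :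
    ∃ C : ℝ, 0 < C ∧ ∀ t x y m : ℝ, 0 < t → 0 < x → 0 < y → x * y ≤ 2 * t → (m = x ∨ m = y) →
      Wexo ν t x y * y ^ (2 * ν + 1) ≤ C * (x ^ (-(2 * ν)) * m ^ (2 * ν - 2) * y) := by
  obtain ⟨C, hC, h⟩ := exists_rpow_le_const_mul_exp (a := 1 - ν) (by linarith)
  have hI := besselI_nonneg (μ := -ν) (by linarith) one_pos
  refine ⟨(besselI (-ν) 1 + 1) * C * 2 ^ (1 - ν), by positivity,
    fun t x y m ht hx hy hxy hm => ?_⟩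
  have hmp : 0 < m := by rcases hm with rfl | rfl <;> assumption
  rw [Wexo_mul_rpow ν hx hy]
  have hw : 0 < x * y / (2 * t) := by positivity
  have hw1 : x * y / (2 * t) ≤ 1 := by rw [div_le_one (by positivity)]; exact hxy
  have b1 := besselI_le_of_le_one (μ := -ν) (by linarith) hw hw1
  have b2 : Real.exp (-(x ^ 2 + y ^ 2) / (4 * t)) ≤ C * (m ^ 2 / (4 * t)) ^ (-(1 - ν)) := by
    refine le_trans (Real.exp_le_exp.2 ?_) (h (m ^ 2 / (4 * t)) (by positivity))
    rw [neg_div]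
    gcongr
    rcases hm with rfl | rfl <;> nlinarith
  calc _ ≤ x ^ (-(2 * ν)) * (2 * t)⁻¹ * (x * y) ^ ν * y *
      (C * (m ^ 2 / (4 * t)) ^ (-(1 - ν))) * ((x * y / (2 * t)) ^ (-ν) * (besselI (-ν) 1 + 1)) := by
        have b3 : besselI (-ν) (x * y / (2 * t)) ≤
            (x * y / (2 * t)) ^ (-ν) * (besselI (-ν) 1 + 1) :=
          b1.trans (by gcongr; linarith)
        have b4 := besselI_nonneg (μ := -ν) (by linarith) hw
        gcongr
    _ = _ := by
        have e1 : (2 * t)⁻¹ * (x * y) ^ ν * (m ^ 2 / (4 * t)) ^ (-(1 - ν)) *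
            (x * y / (2 * t)) ^ (-ν) = 2 ^ (1 - ν) * m ^ (2 * ν - 2) := by
          obtain ⟨c, hc⟩ : ∃ c, 2 * t = Real.exp c := ⟨_, (Real.exp_log (by positivity)).symm⟩
          obtain ⟨a, ha⟩ : ∃ a, x * y = Real.exp a := ⟨_, (Real.exp_log (by positivity)).symm⟩
          obtain ⟨b, hb⟩ : ∃ b, m = Real.exp b := ⟨_, (Real.exp_log (by positivity)).symm⟩
          obtain ⟨d, hd⟩ : ∃ d : ℝ, (2 : ℝ) = Real.exp d := ⟨_, (Real.exp_log two_pos).symm⟩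
          have h2 : (2 : ℝ) ^ (1 - ν) = Real.exp (d * (1 - ν)) := by rw [hd, Real.exp_mul]
          have h4 : m ^ 2 / (4 * t) = Real.exp (2 * b - (d + c)) := by
            rw [Real.exp_sub, Real.exp_add, ← hd, ← hc, mul_comm 2 b, Real.exp_mul, ← hb, Real.rpow_two]
            ring
          rw [h2, h4, hc, ha, hb]
          simp only [← Real.exp_add, ← Real.exp_mul, ← Real.exp_neg, ← Real.exp_sub]
          congr 1; ring
        linear_combination (x ^ (-(2 * ν)) * y * C * (besselI (-ν) 1 + 1)) * e1

lemma exists_Wexo_le_of_ge {ν : ℝ} (hν : ν < 1) :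
    ∃ C : ℝ, 0 < C ∧ ∀ t x y : ℝ, 0 < t → 0 < x → 0 < y → 2 * t ≤ x * y →
      Wexo ν t x y * y ^ (2 * ν + 1) ≤ C * (x ^ (-(2 * ν)) * (x * y) ^ (ν - 1 / 2) * y *
        (2 * t) ^ (-(1 / 2) : ℝ) * Real.exp (-((x - y) ^ 2 / (4 * t)))) := by
  obtain ⟨C, hC, h⟩ := exists_besselI_le_of_one_le (μ := -ν) (by linarith)
  refine ⟨C, hC, fun t x y ht hx hy hxy => ?_⟩
  rw [Wexo_mul_rpow ν hx hy]
  have hw1 : 1 ≤ x * y / (2 * t) := by rw [one_le_div (by positivity)]; exact hxy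
  calc _ ≤ x ^ (-(2 * ν)) * (2 * t)⁻¹ * (x * y) ^ ν * y *
      Real.exp (-(x ^ 2 + y ^ 2) / (4 * t)) *
        (C * ((x * y / (2 * t)) ^ (-(1 / 2) : ℝ) * Real.exp (x * y / (2 * t)))) := by
        gcongr; exact h _ hw1
    _ = _ := by
        have e2 : Real.exp (-(x ^ 2 + y ^ 2) / (4 * t)) * Real.exp (x * y / (2 * t)) =
            Real.exp (-((x - y) ^ 2 / (4 * t))) := by
          rw [← Real.exp_add]; congr 1; field_simp; ring
        have e1 : (2 * t)⁻¹ * (x * y) ^ ν * (x * y / (2 * t)) ^ (-(1 / 2) : ℝ) =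
            (x * y) ^ (ν - 1 / 2) * (2 * t) ^ (-(1 / 2) : ℝ) := by
          obtain ⟨c, hc⟩ : ∃ c, 2 * t = Real.exp c := ⟨_, (Real.exp_log (by positivity)).symm⟩
          obtain ⟨a, ha⟩ : ∃ a, x * y = Real.exp a := ⟨_, (Real.exp_log (by positivity)).symm⟩
          rw [hc, ha]
          simp only [← Real.exp_add, ← Real.exp_mul, ← Real.exp_neg, ← Real.exp_sub]
          congr 1; ring
        rw [← e2]
        linear_combination (x ^ (-(2 * ν)) * y * C * Real.exp (-(x ^ 2 + y ^ 2) / (4 * t)) *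
          Real.exp (x * y / (2 * t))) * e1

lemma exists_Wexo_le_off_diagonal {ν : ℝ} (hν : ν < 1) :
    ∃ C : ℝ, 0 < C ∧ ∀ t x y m : ℝ, 0 < t → 0 < x → 0 < y → 2 * t ≤ x * y → 0 < m →
      m / 20 ≤ |x - y| → Wexo ν t x y * y ^ (2 * ν + 1) ≤
        C * (x ^ (-(2 * ν)) * (x * y) ^ (1 / 2 : ℝ) * y * m ^ (2 * ν - 3)) := by
  obtain ⟨C, hC, h⟩ := exists_Wexo_le_of_ge hν
  obtain ⟨C', hC', h'⟩ := exists_rpow_le_const_mul_exp (a := 3 / 2 - ν) (by linarith)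
  refine ⟨C * C' * 800 ^ (3 / 2 - ν), by positivity, fun t x y m ht hx hy hxy hm hmxy => ?_⟩
  refine (h t x y ht hx hy hxy).trans ?_
  have hexp : Real.exp (-((x - y) ^ 2 / (4 * t))) ≤ C' * (m ^ 2 / (1600 * t)) ^ (-(3 / 2 - ν)) := by
    refine le_trans (Real.exp_le_exp.2 ?_) (h' (m ^ 2 / (1600 * t)) (by positivity))
    have : (m / 20) ^ 2 ≤ (x - y) ^ 2 := by
      rw [← sq_abs (x - y)]; gcongr
    rw [neg_le_neg_iff, show m ^ 2 / (1600 * t) = (m / 20) ^ 2 / (4 * t) by field_simp; norm_num]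
    gcongr
  have htp : (2 * t) ^ (1 - ν) ≤ (x * y) ^ (1 - ν) :=
    Real.rpow_le_rpow (by positivity) hxy (by linarith)
  have e1 : (2 * t) ^ (-(1 / 2) : ℝ) * (m ^ 2 / (1600 * t)) ^ (-(3 / 2 - ν)) =
      800 ^ (3 / 2 - ν) * (2 * t) ^ (1 - ν) * m ^ (2 * ν - 3) := by
    obtain ⟨c, hc⟩ : ∃ c, 2 * t = Real.exp c := ⟨_, (Real.exp_log (by positivity)).symm⟩
    obtain ⟨b, hb⟩ : ∃ b, m = Real.exp b := ⟨_, (Real.exp_log (by positivity)).symm⟩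
    obtain ⟨d, hd⟩ : ∃ d : ℝ, (800 : ℝ) = Real.exp d := ⟨_, (Real.exp_log (by norm_num)).symm⟩
    rw [show m ^ 2 / (1600 * t) = m ^ (2 : ℝ) / (800 * (2 * t)) by
      rw [Real.rpow_two]; ring, hc, hb, hd]
    simp only [← Real.exp_add, ← Real.exp_mul, ← Real.exp_sub]
    congr 1; ring
  have e2 : (x * y) ^ (ν - 1 / 2) * (x * y) ^ (1 - ν) = (x * y) ^ (1 / 2 : ℝ) := by
    rw [← Real.rpow_add (by positivity)]; congr 1; ring
  calc _ ≤ C * (x ^ (-(2 * ν)) * (x * y) ^ (ν - 1 / 2) * y * (2 * t) ^ (-(1 / 2) : ℝ) *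
        (C' * (m ^ 2 / (1600 * t)) ^ (-(3 / 2 - ν)))) := by gcongr
    _ = C * C' * 800 ^ (3 / 2 - ν) * (x ^ (-(2 * ν)) * ((x * y) ^ (ν - 1 / 2) *
          (2 * t) ^ (1 - ν)) * y * m ^ (2 * ν - 3)) := by
        linear_combination (C * C' * x ^ (-(2 * ν)) * (x * y) ^ (ν - 1 / 2) * y) * e1
    _ ≤ C * C' * 800 ^ (3 / 2 - ν) * (x ^ (-(2 * ν)) * ((x * y) ^ (ν - 1 / 2) *
          (x * y) ^ (1 - ν)) * y * m ^ (2 * ν - 3)) := by gcongr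
    _ = _ := by rw [e2]

/-- The exotic kernel, as a density in `y`, is dominated by the kernels of two Hardy operators and
a Gauss–Weierstrass kernel cut off to the diagonal. -/
lemma exists_Wexo_le {ν : ℝ} (hν : ν < 1) :
    ∃ K : ℝ, 0 < K ∧ ∀ t x y : ℝ, 0 < t → 0 < x → 0 < y →
      (y < 2 * x ∧ Wexo ν t x y * y ^ (2 * ν + 1) ≤ K * (x ^ (-2 : ℝ) * y)) ∨
      (x < y ∧ Wexo ν t x y * y ^ (2 * ν + 1) ≤ K * (x ^ (-(2 * ν)) * y ^ (2 * ν - 1))) ∨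
      (|x - y| ≤ x / 20 ∧ Wexo ν t x y * y ^ (2 * ν + 1) ≤
        K * ((√t)⁻¹ * Real.exp (-((x - y) ^ 2 / (4 * t))))) := by
  obtain ⟨C₁, hC₁, h₁⟩ := exists_Wexo_le_of_le hν
  obtain ⟨C₂, hC₂, h₂⟩ := exists_Wexo_le_of_ge hν
  obtain ⟨C₃, hC₃, h₃⟩ := exists_Wexo_le_off_diagonal hν
  refine ⟨C₁ + C₂ * 2 ^ |ν + 1 / 2| + C₃ * 2 ^ (1 / 2 : ℝ), by positivity,
    fun t x y ht hx hy => ?_⟩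
  have hK₁ : C₁ ≤ C₁ + C₂ * 2 ^ |ν + 1 / 2| + C₃ * 2 ^ (1 / 2 : ℝ) := by
    have : 0 < C₂ * 2 ^ |ν + 1 / 2| + C₃ * 2 ^ (1 / 2 : ℝ) := by positivity
    linarith
  have hK₂ : C₂ * 2 ^ |ν + 1 / 2| ≤ C₁ + C₂ * 2 ^ |ν + 1 / 2| + C₃ * 2 ^ (1 / 2 : ℝ) := by
    have : 0 < C₃ * (2 : ℝ) ^ (1 / 2 : ℝ) := by positivity
    linarith
  have hK₃ : C₃ * 2 ^ (1 / 2 : ℝ) ≤ C₁ + C₂ * 2 ^ |ν + 1 / 2| + C₃ * 2 ^ (1 / 2 : ℝ) := by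
    have : 0 < C₂ * (2 : ℝ) ^ |ν + 1 / 2| := by positivity
    linarith
  obtain ⟨a, rfl⟩ : ∃ a, x = Real.exp a := ⟨_, (Real.exp_log (by positivity)).symm⟩
  obtain ⟨b, rfl⟩ : ∃ b, y = Real.exp b := ⟨_, (Real.exp_log (by positivity)).symm⟩
  rcases le_total (Real.exp a * Real.exp b) (2 * t) with hxy | hxy
  · rcases lt_or_ge (Real.exp b) (2 * Real.exp a) with hlt | hge
    · refine Or.inl ⟨hlt, (h₁ t _ _ _ ht hx hy hxy (Or.inl rfl)).trans ?_⟩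
      have : Real.exp a ^ (-(2 * ν)) * Real.exp a ^ (2 * ν - 2) = Real.exp a ^ (-2 : ℝ) := by
        rw [← Real.rpow_add hx]; congr 1; ring
      rw [this]; gcongr
    · refine Or.inr (Or.inl ⟨by linarith, (h₁ t _ _ _ ht hx hy hxy (Or.inr rfl)).trans ?_⟩)
      have : Real.exp b ^ (2 * ν - 2) * Real.exp b = Real.exp b ^ (2 * ν - 1) := by
        rw [← Real.rpow_add_one hy.ne']; congr 1; ring
      rw [mul_assoc, this]; gcongr
  · rcases le_or_gt |Real.exp a - Real.exp b| (Real.exp a / 20) with hd | hd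
    · refine Or.inr (Or.inr ⟨hd, (h₂ t _ _ ht hx hy hxy).trans ?_⟩)
      obtain ⟨hd1, hd2⟩ := abs_le.1 hd
      have e1 : Real.exp a ^ (-(2 * ν)) * (Real.exp a * Real.exp b) ^ (ν - 1 / 2) * Real.exp b =
          (Real.exp b / Real.exp a) ^ (ν + 1 / 2) := by
        simp only [← Real.exp_add, ← Real.exp_mul, ← Real.exp_sub]
        congr 1; ring
      have e2 : (Real.exp b / Real.exp a) ^ (ν + 1 / 2) ≤ 2 ^ |ν + 1 / 2| := by
        apply rpow_le_two_rpow_abs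
        · rw [div_le_div_iff₀ two_pos hx]; linarith
        · rw [div_le_iff₀ hx]; linarith
      have e3 : (2 * t) ^ (-(1 / 2) : ℝ) ≤ (√t)⁻¹ := by
        rw [Real.rpow_neg (by positivity), ← Real.sqrt_eq_rpow]
        gcongr; linarith
      rw [e1, ← mul_assoc, mul_comm, mul_comm _ ((√t)⁻¹ * _)]
      calc _ ≤ Real.exp (-((Real.exp a - Real.exp b) ^ 2 / (4 * t))) *
            (C₂ * (2 ^ |ν + 1 / 2| * (√t)⁻¹)) := by gcongr
        _ = (√t)⁻¹ * Real.exp (-((Real.exp a - Real.exp b) ^ 2 / (4 * t))) *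
            (C₂ * 2 ^ |ν + 1 / 2|) := by ring
        _ ≤ _ := by gcongr
    · rcases lt_or_ge (Real.exp b) (2 * Real.exp a) with hlt | hge
      · refine Or.inl ⟨hlt, (h₃ t _ _ _ ht hx hy hxy hx hd.le).trans ?_⟩
        have e1 : Real.exp a ^ (-(2 * ν)) * (Real.exp a * Real.exp b) ^ (1 / 2 : ℝ) * Real.exp b *
            Real.exp a ^ (2 * ν - 3) =
            (Real.exp b / Real.exp a) ^ (1 / 2 : ℝ) * (Real.exp a ^ (-2 : ℝ) * Real.exp b) := by
          simp only [← Real.exp_add, ← Real.exp_mul, ← Real.exp_sub]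
          congr 1; ring
        have e2 : (Real.exp b / Real.exp a) ^ (1 / 2 : ℝ) ≤ 2 ^ (1 / 2 : ℝ) := by
          gcongr; rw [div_le_iff₀ hx]; linarith
        rw [e1, ← mul_assoc]
        gcongr
        exact (mul_le_mul_of_nonneg_left e2 hC₃.le).trans hK₃
      · refine Or.inr (Or.inl ⟨by linarith, (h₃ t _ _ _ ht hx hy hxy hy ?_).trans ?_⟩)
        · rw [abs_sub_comm]; exact le_trans (by linarith) (le_abs_self _)
        have e1 : Real.exp a ^ (-(2 * ν)) * (Real.exp a * Real.exp b) ^ (1 / 2 : ℝ) * Real.exp b *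
            Real.exp b ^ (2 * ν - 3) = (Real.exp a / Real.exp b) ^ (1 / 2 : ℝ) *
              (Real.exp a ^ (-(2 * ν)) * Real.exp b ^ (2 * ν - 1)) := by
          simp only [← Real.exp_add, ← Real.exp_mul, ← Real.exp_sub]
          congr 1; ring
        have e2 : (Real.exp a / Real.exp b) ^ (1 / 2 : ℝ) ≤ 2 ^ (1 / 2 : ℝ) := by
          gcongr; rw [div_le_iff₀ hy]; linarith
        rw [e1, ← mul_assoc]
        gcongr
        exact (mul_le_mul_of_nonneg_left e2 hC₃.le).trans hK₃

end Kernel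

section Hardy

lemma measurable_ofReal_rpow (δ : ℝ) : Measurable fun x : ℝ => ENNReal.ofReal (x ^ δ) := by
  fun_prop

instance (δ : ℝ) : SFinite (powMeasure δ) := by unfold powMeasure; infer_instance

lemma powMeasure_apply (δ : ℝ) (s : Set ℝ) :
    powMeasure δ s = ∫⁻ x in s, ENNReal.ofReal (x ^ δ) ∂(volume.restrict (Ioi 0)) :=
  withDensity_apply' _ s

lemma lintegral_powMeasure (δ : ℝ) (f : ℝ → ℝ≥0∞) :
    ∫⁻ x, f x ∂(powMeasure δ) = ∫⁻ x in Ioi 0, ENNReal.ofReal (x ^ δ) * f x := by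
  unfold powMeasure
  rw [lintegral_withDensity_eq_lintegral_mul_non_measurable _ (measurable_ofReal_rpow δ)
    (ae_of_all _ fun x => ENNReal.ofReal_lt_top)]
  rfl

lemma lintegral_rpow_mul_powMeasure (a δ : ℝ) (f : ℝ → ℝ≥0∞) :
    ∫⁻ x, ENNReal.ofReal (x ^ a) * f x ∂(powMeasure δ) = ∫⁻ x, f x ∂(powMeasure (δ + a)) := by
  rw [lintegral_powMeasure, lintegral_powMeasure]
  refine setLIntegral_congr_fun measurableSet_Ioi fun x (hx : 0 < x) => ?_
  rw [← mul_assoc, ← ENNReal.ofReal_mul (by positivity), ← Real.rpow_add hx]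

lemma ae_powMeasure_pos (δ : ℝ) : ∀ᵐ x ∂(powMeasure δ), 0 < x :=
  (withDensity_absolutelyContinuous _ _).ae_le (ae_restrict_mem measurableSet_Ioi)

lemma powMeasure_mono {δ : ℝ} {s t : Set ℝ} (h : ∀ x, 0 < x → x ∈ s → x ∈ t) :
    powMeasure δ s ≤ powMeasure δ t := by
  refine measure_mono_ae ?_
  filter_upwards [ae_powMeasure_pos δ] with x hx hxs using h x hx hxs

lemma powMeasure_rpow_le {a : ℝ} (ha : a ≠ 0) {u : ℝ} (hu : 0 ≤ u) :
    powMeasure (a - 1) {x | x ^ a ≤ u} ≤ ENNReal.ofReal (u / |a|) := by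
  rcases hu.eq_or_lt with rfl | hu
  · refine (powMeasure_mono (t := ∅) fun x hx hxs => ?_).trans (by simp)
    exact absurd hxs (not_le.2 (Real.rpow_pos_of_pos hx a))
  set c := u ^ (1 / a) with hc
  have hc0 : 0 < c := by positivity
  have hca : c ^ a = u := by rw [hc, ← Real.rpow_mul hu.le]; simp [ha]
  rcases ha.lt_or_gt with ha' | ha'
  · have hle : powMeasure (a - 1) {x | x ^ a ≤ u} ≤ powMeasure (a - 1) (Ici c) := by
      refine powMeasure_mono fun x hx (hxs : x ^ a ≤ u) => ?_
      rw [← hca] at hxs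
      exact (Real.rpow_le_rpow_iff_of_neg hx hc0 ha').1 hxs
    refine hle.trans ?_
    rw [powMeasure_apply, Measure.restrict_restrict measurableSet_Ici,
      inter_eq_self_of_subset_left (Ici_subset_Ioi.2 hc0), setLIntegral_congr Ioi_ae_eq_Ici.symm,
      ← ofReal_integral_eq_lintegral_ofReal
        (integrableOn_Ioi_rpow_of_lt (by linarith) hc0), integral_Ioi_rpow_of_lt (by linarith) hc0,
      sub_add_cancel, hca, abs_of_neg ha', neg_div, div_neg]
    filter_upwards [ae_restrict_mem measurableSet_Ioi] with x hx
    exact Real.rpow_nonneg (hc0.trans hx).le _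
  · have hle : powMeasure (a - 1) {x | x ^ a ≤ u} ≤ powMeasure (a - 1) (Ioc 0 c) := by
      refine powMeasure_mono fun x hx (hxs : x ^ a ≤ u) => ⟨hx, ?_⟩
      rw [← hca] at hxs
      exact (Real.rpow_le_rpow_iff hx.le hc0.le ha').1 hxs
    refine hle.trans ?_
    rw [powMeasure_apply, Measure.restrict_restrict measurableSet_Ioc,
      inter_eq_self_of_subset_left Ioc_subset_Ioi_self,
      ← ofReal_integral_eq_lintegral_ofReal, ← intervalIntegral.integral_of_le hc0.le,
      integral_rpow (Or.inl (by linarith)), sub_add_cancel, Real.zero_rpow ha, hca, sub_zero,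
      abs_of_pos ha']
    · exact (intervalIntegrable_iff_integrableOn_Ioc_of_le hc0.le).1
        (intervalIntegral.intervalIntegrable_rpow' (by linarith))
    · filter_upwards [ae_restrict_mem measurableSet_Ioc] with x hx
      exact Real.rpow_nonneg hx.1.le _

/-- Among sets of given `x^(a-1) dx` measure, the `x^(ap-1) dx` measure is smallest for sublevel
sets of `x^a`. -/
lemma powMeasure_rpow_le_powMeasure {a p : ℝ} (ha : a ≠ 0) (hp : 1 ≤ p) {E : Set ℝ}
    (hE : MeasurableSet E) :
    powMeasure (a - 1) E ^ p ≤
      ENNReal.ofReal ((1 / |a| + 1) ^ p) * powMeasure (a * p - 1) E := by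
  have hp0 : 0 < p := by linarith
  have ha' : 0 < |a| := abs_pos.2 ha
  have hD : 0 < (1 / |a| + 1) ^ p := by positivity
  have key : ∀ g : ℝ, 0 < g → powMeasure (a * p - 1) E ≤ ENNReal.ofReal g →
      powMeasure (a - 1) E ≤ ENNReal.ofReal ((1 / |a| + 1) * g ^ (1 / p)) := by
    intro g hg hG
    set u := g ^ (1 / p) with hu
    have hu0 : 0 < u := by positivity
    have hup : u ^ (1 - p) * g = u := by
      rw [hu, ← Real.rpow_mul hg.le]
      nth_rewrite 2 [← Real.rpow_one g]
      rw [← Real.rpow_add hg]; congr 1; field_simp; ring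
    have hms : MeasurableSet {x : ℝ | u < x ^ a} := measurableSet_lt measurable_const (by fun_prop)
    have hsub : E ⊆ {x | x ^ a ≤ u} ∪ E ∩ {x | u < x ^ a} := fun x hx => by
      rcases le_or_gt (x ^ a) u with h | h
      · exact Or.inl h
      · exact Or.inr ⟨hx, h⟩
    have hfar : powMeasure (a - 1) (E ∩ {x | u < x ^ a}) ≤ ENNReal.ofReal u := by
      calc powMeasure (a - 1) (E ∩ {x | u < x ^ a})
          ≤ ∫⁻ x in E ∩ {x | u < x ^ a}, ENNReal.ofReal (u ^ (1 - p)) *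
              ENNReal.ofReal (x ^ (a * p - 1)) ∂(volume.restrict (Ioi 0)) := by
            rw [powMeasure_apply]
            refine lintegral_mono_ae ?_
            filter_upwards [ae_restrict_mem (hE.inter hms),
              ae_restrict_of_ae (ae_restrict_mem measurableSet_Ioi)] with x hx hx0
            have hx0 : 0 < x := hx0
            have hxu : u < x ^ a := hx.2
            rw [← ENNReal.ofReal_mul (by positivity)]
            refine ENNReal.ofReal_le_ofReal ?_
            have e : x ^ (a * p - 1) = x ^ (a - 1) * (x ^ a) ^ (p - 1) := by
              rw [← Real.rpow_mul hx0.le, ← Real.rpow_add hx0]; congr 1; ring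
            have h1 : u ^ (p - 1) ≤ (x ^ a) ^ (p - 1) :=
              Real.rpow_le_rpow hu0.le hxu.le (by linarith)
            have h2 : u ^ (1 - p) * u ^ (p - 1) = 1 := by
              rw [← Real.rpow_add hu0]; simp
            rw [e]
            calc x ^ (a - 1) = x ^ (a - 1) * (u ^ (1 - p) * u ^ (p - 1)) := by rw [h2, mul_one]
              _ ≤ x ^ (a - 1) * (u ^ (1 - p) * (x ^ a) ^ (p - 1)) := by gcongr
              _ = _ := by ring
        _ = ENNReal.ofReal (u ^ (1 - p)) * powMeasure (a * p - 1) (E ∩ {x | u < x ^ a}) := by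
            rw [lintegral_const_mul _ (measurable_ofReal_rpow _), powMeasure_apply]
        _ ≤ ENNReal.ofReal (u ^ (1 - p)) * ENNReal.ofReal g := by
            gcongr
            exact (measure_mono inter_subset_left).trans hG
        _ = ENNReal.ofReal u := by rw [← ENNReal.ofReal_mul (by positivity), hup]
    calc powMeasure (a - 1) E ≤ _ := measure_mono hsub
      _ ≤ _ := measure_union_le _ _
      _ ≤ ENNReal.ofReal (u / |a|) + ENNReal.ofReal u := by
          gcongr; exact powMeasure_rpow_le ha hu0.le
      _ = _ := by
          rw [← ENNReal.ofReal_add (by positivity) hu0.le]; congr 1; ring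
  have hD1 : ENNReal.ofReal ((1 / |a| + 1) ^ p) ≠ 0 := by
    simpa using hD
  rw [mul_comm, ← ENNReal.div_le_iff hD1 ENNReal.ofReal_ne_top]
  refine le_of_forall_gt_imp_ge_of_dense fun c hc => ?_
  rcases eq_or_ne c ⊤ with rfl | hct
  · exact le_top
  have hc0 : 0 < c.toReal := ENNReal.toReal_pos (pos_of_gt hc).ne' hct
  rw [ENNReal.div_le_iff hD1 ENNReal.ofReal_ne_top]
  have := key c.toReal hc0 (by rw [ENNReal.ofReal_toReal hct]; exact hc.le)
  calc powMeasure (a - 1) E ^ p ≤ ENNReal.ofReal ((1 / |a| + 1) * c.toReal ^ (1 / p)) ^ p := by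
        gcongr
    _ = ENNReal.ofReal (c.toReal * (1 / |a| + 1) ^ p) := by
        rw [ENNReal.ofReal_rpow_of_nonneg (by positivity) hp0.le,
          Real.mul_rpow (by positivity) (by positivity), ← Real.rpow_mul hc0.le,
          one_div_mul_cancel hp0.ne', Real.rpow_one, mul_comm]
    _ = c * ENNReal.ofReal ((1 / |a| + 1) ^ p) := by
        rw [ENNReal.ofReal_mul hc0.le, ENNReal.ofReal_toReal hct]

lemma exists_hardy_weak_type {b δ c : ℝ} (hb : b ≠ 0) (hc : 0 ≤ c) {R : ℝ → ℝ → Prop}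
    (hR : MeasurableSet {q : ℝ × ℝ | R q.1 q.2})
    (hRc : δ - b + 1 ≠ 0 → ∀ x y, 0 < x → 0 < y → R x y →
      x ^ (δ - b + 1) ≤ c * y ^ (δ - b + 1)) :
    ∃ C : ℝ≥0, ∀ E : Set ℝ, MeasurableSet E → powMeasure δ E < ⊤ → ∀ l : ℝ, 0 < l →
      ENNReal.ofReal l * powMeasure δ {x | 0 < x ∧ ENNReal.ofReal l <
        ENNReal.ofReal (x ^ (-b)) * powMeasure (b - 1) (E ∩ {y | R x y})} ≤
      C * powMeasure δ E := by
  by_cases hs : δ - b + 1 = 0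
  · refine ⟨(1 / |b|).toNNReal, fun E hE hEf l hl => ?_⟩
    obtain rfl : δ = b - 1 := by linarith
    have hA := ENNReal.ofReal_toReal hEf.ne
    set A := (powMeasure (b - 1) E).toReal
    have hA0 : 0 ≤ A := ENNReal.toReal_nonneg
    have hsub : powMeasure (b - 1) {x | 0 < x ∧ ENNReal.ofReal l <
        ENNReal.ofReal (x ^ (-b)) * powMeasure (b - 1) (E ∩ {y | R x y})} ≤
        ENNReal.ofReal (A / l / |b|) := by
      refine le_trans (measure_mono ?_) (powMeasure_rpow_le hb (by positivity : 0 ≤ A / l))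
      rintro x ⟨hx, hxl⟩
      have h1 : ENNReal.ofReal l < ENNReal.ofReal (x ^ (-b) * A) := by
        rw [ENNReal.ofReal_mul (by positivity), hA]
        exact hxl.trans_le (by gcongr; exact inter_subset_left)
      have h2 := (ENNReal.ofReal_lt_ofReal_iff_of_nonneg hl.le).1 h1
      rw [Real.rpow_neg hx.le, inv_mul_eq_div, lt_div_iff₀ (by positivity)] at h2
      simp only [mem_ofPred_eq]
      rw [le_div_iff₀ hl]; linarith
    calc _ ≤ ENNReal.ofReal l * ENNReal.ofReal (A / l / |b|) := by gcongr
      _ = ENNReal.ofReal (1 / |b|) * ENNReal.ofReal A := by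
          rw [← ENNReal.ofReal_mul hl.le, ← ENNReal.ofReal_mul (by positivity)]
          congr 1; field_simp
      _ = _ := by rw [hA]; rfl
  · refine ⟨(c / |δ - b + 1|).toNNReal, fun E hE hEf l hl => ?_⟩
    set s := δ - b + 1 with hsdef
    have hS : MeasurableSet {q : ℝ × ℝ | q.2 ∈ E ∧ R q.1 q.2} :=
      (measurable_snd hE).inter hR
    have hmeas : Measurable fun x => powMeasure (b - 1) (E ∩ {y | R x y}) :=
      measurable_measure_prodMk_left hS
    have hf : Measurable fun x => ENNReal.ofReal (x ^ (-b)) *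
        powMeasure (b - 1) (E ∩ {y | R x y}) := (measurable_ofReal_rpow _).mul hmeas
    calc _ ≤ ENNReal.ofReal l * powMeasure δ {x | ENNReal.ofReal l ≤
          ENNReal.ofReal (x ^ (-b)) * powMeasure (b - 1) (E ∩ {y | R x y})} := by
          refine mul_le_mul_right (measure_mono ?_) _
          rintro x ⟨-, h⟩
          exact h.le
      _ ≤ ∫⁻ x, ENNReal.ofReal (x ^ (-b)) * powMeasure (b - 1) (E ∩ {y | R x y})
            ∂(powMeasure δ) := mul_meas_ge_le_lintegral hf _
      _ = ∫⁻ x, powMeasure (b - 1) (E ∩ {y | R x y}) ∂(powMeasure (s - 1)) := by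
          rw [lintegral_rpow_mul_powMeasure]; congr 2; rw [hsdef]; ring
      _ = ((powMeasure (s - 1)).prod (powMeasure (b - 1))) {q | q.2 ∈ E ∧ R q.1 q.2} :=
          (Measure.prod_apply hS).symm
      _ = ∫⁻ y, powMeasure (s - 1) {x | y ∈ E ∧ R x y} ∂(powMeasure (b - 1)) :=
          Measure.prod_apply_symm hS
      _ ≤ ∫⁻ y, ENNReal.ofReal (y ^ s) * (ENNReal.ofReal (c / |s|) * E.indicator 1 y)
            ∂(powMeasure (b - 1)) := by
          refine lintegral_mono_ae ?_
          filter_upwards [ae_powMeasure_pos (b - 1)] with y hy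
          by_cases hyE : y ∈ E
          · simp only [hyE, true_and, indicator_of_mem, Pi.one_apply, mul_one]
            refine (powMeasure_mono (t := {x | x ^ s ≤ c * y ^ s}) fun x hx hxR =>
              hRc hs x y hx hy hxR).trans ?_
            refine (powMeasure_rpow_le hs (by positivity)).trans_eq ?_
            rw [← ENNReal.ofReal_mul (by positivity)]; congr 1; ring
          · simp [hyE]
      _ = ENNReal.ofReal (c / |s|) * powMeasure δ E := by
          rw [lintegral_rpow_mul_powMeasure, lintegral_const_mul _ (measurable_one.indicator hE),
            lintegral_indicator_one hE]
          congr 2; rw [hsdef]; ring_nf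
      _ = _ := rfl

lemma exists_hardy_restricted_weak_type {a p δ c : ℝ} (ha : a ≠ 0) (hp : 1 ≤ p) (hc : 0 ≤ c)
    {R : ℝ → ℝ → Prop} (hR : MeasurableSet {q : ℝ × ℝ | R q.1 q.2})
    (hRc : δ - a * p + 1 ≠ 0 → ∀ x y, 0 < x → 0 < y → R x y →
      x ^ (δ - a * p + 1) ≤ c * y ^ (δ - a * p + 1)) :
    ∃ C : ℝ≥0, ∀ E : Set ℝ, MeasurableSet E → powMeasure δ E < ⊤ → ∀ l : ℝ, 0 < l →
      ENNReal.ofReal (l ^ p) * powMeasure δ {x | 0 < x ∧ ENNReal.ofReal l <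
        ENNReal.ofReal (x ^ (-a)) * powMeasure (a - 1) (E ∩ {y | R x y})} ≤
      C * powMeasure δ E := by
  have hp0 : 0 < p := by linarith
  obtain ⟨C, hC⟩ := exists_hardy_weak_type (mul_ne_zero ha hp0.ne') hc hR hRc
  have hD : 0 < (1 / |a| + 1) ^ p := by positivity
  set D := (1 / |a| + 1) ^ p with hDdef
  refine ⟨D.toNNReal * C, fun E hE hEf l hl => ?_⟩
  have hl' : 0 < l ^ p / D := by positivity
  have h := hC E hE hEf _ hl'
  have hsub : {x | 0 < x ∧ ENNReal.ofReal l <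
        ENNReal.ofReal (x ^ (-a)) * powMeasure (a - 1) (E ∩ {y | R x y})} ⊆
      {x | 0 < x ∧ ENNReal.ofReal (l ^ p / D) <
        ENNReal.ofReal (x ^ (-(a * p))) * powMeasure (a * p - 1) (E ∩ {y | R x y})} := by
    rintro x ⟨hx, hxl⟩
    refine ⟨hx, ?_⟩
    have hRx : MeasurableSet {y | R x y} := measurable_prodMk_left hR
    have h1 := ENNReal.rpow_lt_rpow hxl hp0
    rw [ENNReal.mul_rpow_of_nonneg _ _ hp0.le, ENNReal.ofReal_rpow_of_pos hl,
      ENNReal.ofReal_rpow_of_pos (by positivity), ← Real.rpow_mul hx.le] at h1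
    have h2 := h1.trans_le (mul_le_mul_right (powMeasure_rpow_le_powMeasure ha hp (hE.inter hRx)) _)
    rw [ENNReal.ofReal_div_of_pos hD]
    refine ENNReal.div_lt_of_lt_mul' ?_
    rw [neg_mul] at h2
    rw [mul_left_comm]; exact h2
  calc _ ≤ ENNReal.ofReal (l ^ p) * powMeasure δ {x | 0 < x ∧ ENNReal.ofReal (l ^ p / D) <
        ENNReal.ofReal (x ^ (-(a * p))) * powMeasure (a * p - 1) (E ∩ {y | R x y})} := by gcongr
    _ = ENNReal.ofReal D * (ENNReal.ofReal (l ^ p / D) * powMeasure δ {x | 0 < x ∧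
        ENNReal.ofReal (l ^ p / D) < ENNReal.ofReal (x ^ (-(a * p))) *
          powMeasure (a * p - 1) (E ∩ {y | R x y})}) := by
        rw [← mul_assoc, ← ENNReal.ofReal_mul hD.le, mul_div_cancel₀ _ hD.ne']
    _ ≤ ENNReal.ofReal D * (C * powMeasure δ E) := by gcongr
    _ = _ := by rw [← mul_assoc, ENNReal.coe_mul]; rfl

end Hardy

section Local

lemma exists_gaussian_le :
    ∃ C : ℝ, 0 < C ∧ ∀ (F : Set ℝ) (x a : ℝ), 0 ≤ a →
      (∀ r : ℝ, 0 < r → volume (F ∩ Metric.closedBall x r) ≤ ENNReal.ofReal (a * r)) →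
      ∀ t : ℝ, 0 < t →
        ∫⁻ y in F, ENNReal.ofReal ((√t)⁻¹ * Real.exp (-((x - y) ^ 2 / (4 * t)))) ≤
          ENNReal.ofReal (C * a) := by
  have hsum : Summable fun n : ℕ => ((n : ℝ) + 1) * Real.exp (-(1 / 4) * n) := by
    have h1 := Real.summable_pow_mul_exp_neg_nat_mul 1 (by norm_num : (0 : ℝ) < 1 / 4)
    have h0 := Real.summable_pow_mul_exp_neg_nat_mul 0 (by norm_num : (0 : ℝ) < 1 / 4)
    refine (h1.add h0).congr fun n => ?_
    ring
  have hpos : 0 < ∑' n : ℕ, ((n : ℝ) + 1) * Real.exp (-(1 / 4) * n) :=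
    hsum.tsum_pos (fun n => by positivity) 0 (by positivity)
  refine ⟨_, hpos, fun F x a ha hF t ht => ?_⟩
  set s := √t with hs
  have hs0 : 0 < s := Real.sqrt_pos.2 ht
  have hst : t = s ^ 2 := (Real.sq_sqrt ht.le).symm
  have hpt : ∀ y : ℝ, ENNReal.ofReal (s⁻¹ * Real.exp (-((x - y) ^ 2 / (4 * t)))) ≤
      ∑' n : ℕ, ENNReal.ofReal (s⁻¹ * Real.exp (-(1 / 4) * n)) *
        (Metric.closedBall x (((n : ℝ) + 1) * s)).indicator 1 y := by
    intro y
    have hfl := Nat.floor_le (by positivity : 0 ≤ |x - y| / s)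
    have hlt := Nat.lt_floor_add_one (|x - y| / s)
    set n := ⌊|x - y| / s⌋₊
    refine le_trans ?_ (ENNReal.le_tsum n)
    rw [indicator_of_mem, Pi.one_apply, mul_one]
    · refine ENNReal.ofReal_le_ofReal ?_
      gcongr
      have h1 : (n : ℝ) ≤ (n : ℝ) ^ 2 := by exact_mod_cast Nat.le_self_pow two_ne_zero n
      have h2 : (n : ℝ) ^ 2 ≤ (|x - y| / s) ^ 2 := by gcongr
      have h3 : (x - y) ^ 2 / (4 * t) = (|x - y| / s) ^ 2 / 4 := by
        rw [div_pow, sq_abs, hst]; field_simp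
      rw [h3]; linarith
    · rw [div_lt_iff₀ hs0] at hlt
      rw [Metric.mem_closedBall, dist_comm, Real.dist_eq]
      exact hlt.le
  calc _ ≤ ∫⁻ y in F, ∑' n : ℕ, ENNReal.ofReal (s⁻¹ * Real.exp (-(1 / 4) * n)) *
        (Metric.closedBall x (((n : ℝ) + 1) * s)).indicator 1 y := lintegral_mono hpt
    _ = ∑' n : ℕ, ENNReal.ofReal (s⁻¹ * Real.exp (-(1 / 4) * n)) *
        volume (F ∩ Metric.closedBall x (((n : ℝ) + 1) * s)) := by
        have hb : ∀ n : ℕ, MeasurableSet (Metric.closedBall x (((n : ℝ) + 1) * s)) := fun n =>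
          Metric.isClosed_closedBall.measurableSet
        rw [lintegral_tsum fun n =>
          (((measurable_one.indicator (hb n)).const_mul _).aemeasurable)]
        refine tsum_congr fun n => ?_
        rw [lintegral_const_mul _ (measurable_one.indicator (hb n)), lintegral_indicator_one (hb n),
          Measure.restrict_apply (hb n), inter_comm]
    _ ≤ ∑' n : ℕ, ENNReal.ofReal (((n : ℝ) + 1) * Real.exp (-(1 / 4) * n)) *
          ENNReal.ofReal a := by
        refine ENNReal.tsum_le_tsum fun n => ?_
        refine (mul_le_mul_right (hF _ (by positivity)) _).trans_eq ?_
        rw [← ENNReal.ofReal_mul (by positivity), ← ENNReal.ofReal_mul (by positivity)]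
        congr 1; field_simp
    _ = _ := by
        rw [ENNReal.tsum_mul_right, ← ENNReal.ofReal_tsum_of_nonneg (fun n => by positivity) hsum,
          ENNReal.ofReal_mul hpos.le]

lemma half_le_of_mem_closedBall {b y : ℝ} (hb : 0 < b) (hy : y ∈ Metric.closedBall b (b / 2)) :
    0 < y ∧ 1 / 2 ≤ y / b ∧ y / b ≤ 2 := by
  rw [Real.closedBall_eq_Icc] at hy
  refine ⟨by linarith [hy.1], ?_, ?_⟩
  · rw [le_div_iff₀ hb]; linarith [hy.1]
  · rw [div_le_iff₀ hb]; linarith [hy.2]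

lemma powMeasure_le_mul_volume (δ : ℝ) {b : ℝ} (hb : 0 < b) {G : Set ℝ} (hG : MeasurableSet G)
    (hGb : G ⊆ Metric.closedBall b (b / 2)) :
    powMeasure δ G ≤ ENNReal.ofReal (2 ^ |δ| * b ^ δ) * volume G := by
  rw [powMeasure_apply, Measure.restrict_restrict hG, inter_eq_self_of_subset_left
    (t := Ioi 0) fun y hy => (half_le_of_mem_closedBall hb (hGb hy)).1, ← setLIntegral_const]
  refine setLIntegral_mono measurable_const fun y hy => ENNReal.ofReal_le_ofReal ?_
  obtain ⟨h0, h1, h2⟩ := half_le_of_mem_closedBall hb (hGb hy)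
  have := rpow_le_two_rpow_abs h1 h2 δ
  rwa [Real.div_rpow h0.le hb.le, div_le_iff₀ (by positivity)] at this

lemma volume_le_mul_powMeasure (δ : ℝ) {b : ℝ} (hb : 0 < b) {G : Set ℝ} (hG : MeasurableSet G)
    (hGb : G ⊆ Metric.closedBall b (b / 2)) :
    volume G ≤ ENNReal.ofReal (2 ^ |δ| * b ^ (-δ)) * powMeasure δ G := by
  rw [powMeasure_apply, Measure.restrict_restrict hG, inter_eq_self_of_subset_left
    (t := Ioi 0) fun y hy => (half_le_of_mem_closedBall hb (hGb hy)).1,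
    ← lintegral_const_mul _ (measurable_ofReal_rpow δ), ← setLIntegral_one]
  refine setLIntegral_mono ((measurable_ofReal_rpow δ).const_mul _) fun y hy => ?_
  obtain ⟨h0, h1, h2⟩ := half_le_of_mem_closedBall hb (hGb hy)
  have := rpow_le_two_rpow_abs h1 h2 (-δ)
  rw [← ENNReal.ofReal_mul (by positivity), ENNReal.one_le_ofReal]
  rw [abs_neg, Real.div_rpow h0.le hb.le, Real.rpow_neg h0.le, div_le_iff₀ (by positivity)] at this
  calc (1 : ℝ) = (y ^ δ)⁻¹ * y ^ δ := (inv_mul_cancel₀ (by positivity)).symm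
    _ ≤ _ := by gcongr

lemma exists_local_weak_type (δ : ℝ) :
    ∃ C : ℝ≥0, ∀ E : Set ℝ, MeasurableSet E → ∀ a : ℝ, 0 < a →
      ENNReal.ofReal a * powMeasure δ {x | 0 < x ∧ ∃ r : ℝ, 0 < r ∧ r ≤ x / 20 ∧
        ENNReal.ofReal (a * r) < volume (E ∩ Metric.closedBall x r)} ≤ C * powMeasure δ E := by
  refine ⟨((10 : ℝ) * 2 ^ |δ| * 2 ^ |δ|).toNNReal, fun E hE a ha => ?_⟩
  set S := {x : ℝ | 0 < x ∧ ∃ r : ℝ, 0 < r ∧ r ≤ x / 20 ∧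
        ENNReal.ofReal (a * r) < volume (E ∩ Metric.closedBall x r)} with hS
  have hSU : S = ⋃ K : ℕ, S ∩ Iio (K : ℝ) := by
    rw [← inter_iUnion]
    refine (inter_eq_self_of_subset_left fun x _ => ?_).symm
    obtain ⟨K, hK⟩ := exists_nat_gt x
    exact mem_iUnion.2 ⟨K, hK⟩
  have hmono : Monotone fun K : ℕ => S ∩ Iio (K : ℝ) := fun K L hKL =>
    inter_subset_inter_right _ (Iio_subset_Iio (by exact_mod_cast hKL))
  rw [hSU, hmono.measure_iUnion, ENNReal.mul_iSup]
  refine iSup_le fun K => ?_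
  have hex : ∀ x : ℝ, ∃ r : ℝ, x ∈ S → 0 < r ∧ r ≤ x / 20 ∧
      ENNReal.ofReal (a * r) < volume (E ∩ Metric.closedBall x r) := fun x => by
    by_cases hx : x ∈ S
    · obtain ⟨r, hr⟩ := hx.2
      exact ⟨r, fun _ => hr⟩
    · exact ⟨0, fun h => absurd h hx⟩
  choose r hr using hex
  obtain ⟨u, huS, hdisj, hcov⟩ := Vitali.exists_disjoint_subfamily_covering_enlargement_closedBall
    (S ∩ Iio (K : ℝ)) id r (K / 20) (fun x hx => by
      have h1 := (hr x hx.1).2.1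
      have h2 : x < K := hx.2
      linarith) 5 (by norm_num)
  simp only [id] at hdisj hcov
  have hu : u.Countable := hdisj.countable_of_nonempty_interior fun x hx => by
    have := (hr x (huS hx).1).1
    exact ⟨x, mem_interior_iff_mem_nhds.2 (Metric.closedBall_mem_nhds x this)⟩
  have hsub : S ∩ Iio (K : ℝ) ⊆ ⋃ b ∈ u, Metric.closedBall b (5 * r b) := fun x hx => by
    obtain ⟨b, hb, hxb⟩ := hcov x hx
    exact mem_iUnion₂.2 ⟨b, hb, hxb (Metric.mem_closedBall_self (hr x hx.1).1.le)⟩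
  have hball : ∀ b ∈ u, ENNReal.ofReal a * powMeasure δ (Metric.closedBall b (5 * r b)) ≤
      ENNReal.ofReal (10 * 2 ^ |δ| * 2 ^ |δ|) *
        powMeasure δ (E ∩ Metric.closedBall b (r b)) := by
    intro b hb
    have hbS := (huS hb).1
    have hb0 : 0 < b := hbS.1
    obtain ⟨h0, h1, h2⟩ := hr b hbS
    have m1 := powMeasure_le_mul_volume δ hb0 (Metric.isClosed_closedBall.measurableSet)
      (Metric.closedBall_subset_closedBall (by linarith) :
        Metric.closedBall b (5 * r b) ⊆ Metric.closedBall b (b / 2))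
    have m2 := volume_le_mul_powMeasure δ hb0
      (hE.inter (Metric.isClosed_closedBall (x := b) (ε := r b)).measurableSet)
      (inter_subset_right.trans (Metric.closedBall_subset_closedBall (by linarith)))
    rw [Real.volume_closedBall] at m1
    calc _ ≤ ENNReal.ofReal a * (ENNReal.ofReal (2 ^ |δ| * b ^ δ) *
          ENNReal.ofReal (2 * (5 * r b))) := by gcongr
      _ = ENNReal.ofReal (10 * 2 ^ |δ| * b ^ δ) * ENNReal.ofReal (a * r b) := by
          rw [← ENNReal.ofReal_mul (by positivity), ← ENNReal.ofReal_mul (by positivity),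
            ← ENNReal.ofReal_mul (by positivity)]
          congr 1; ring
      _ ≤ ENNReal.ofReal (10 * 2 ^ |δ| * b ^ δ) * (ENNReal.ofReal (2 ^ |δ| * b ^ (-δ)) *
          powMeasure δ (E ∩ Metric.closedBall b (r b))) := by
          exact mul_le_mul_right (h2.le.trans m2) _
      _ = _ := by
          rw [← mul_assoc, ← ENNReal.ofReal_mul (by positivity)]
          congr 2
          rw [Real.rpow_neg hb0.le]; field_simp
  have : Countable u := hu
  calc _ ≤ ENNReal.ofReal a * powMeasure δ (⋃ b ∈ u, Metric.closedBall b (5 * r b)) := by gcongr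
    _ ≤ ENNReal.ofReal a * ∑' b : u, powMeasure δ (Metric.closedBall (b : ℝ) (5 * r b)) := by
        gcongr; exact measure_biUnion_le _ hu _
    _ = ∑' b : u, ENNReal.ofReal a * powMeasure δ (Metric.closedBall (b : ℝ) (5 * r b)) :=
        ENNReal.tsum_mul_left.symm
    _ ≤ ∑' b : u, ENNReal.ofReal (10 * 2 ^ |δ| * 2 ^ |δ|) *
          powMeasure δ (E ∩ Metric.closedBall (b : ℝ) (r b)) :=
        ENNReal.tsum_le_tsum fun b => hball b b.2
    _ = ENNReal.ofReal (10 * 2 ^ |δ| * 2 ^ |δ|) *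
          powMeasure δ (⋃ b ∈ u, E ∩ Metric.closedBall b (r b)) := by
        rw [ENNReal.tsum_mul_left, measure_biUnion hu]
        · exact hdisj.mono fun b => inter_subset_right
        · exact fun b _ => hE.inter Metric.isClosed_closedBall.measurableSet
    _ ≤ _ := by
        refine mul_le_mul_right (measure_mono ?_) _
        exact iUnion₂_subset fun b _ => inter_subset_left

lemma exists_local_restricted_weak_type (δ : ℝ) {p : ℝ} (hp : 1 ≤ p) :
    ∃ C : ℝ≥0, ∀ E : Set ℝ, MeasurableSet E → ∀ a : ℝ, 0 < a →
      ENNReal.ofReal (a ^ p) * powMeasure δ {x | 0 < x ∧ ∃ r : ℝ, 0 < r ∧ r ≤ x / 20 ∧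
        ENNReal.ofReal (a * r) < volume (E ∩ Metric.closedBall x r)} ≤ C * powMeasure δ E := by
  obtain ⟨C, hC⟩ := exists_local_weak_type δ
  refine ⟨((2 : ℝ) ^ (p - 1)).toNNReal * C, fun E hE a ha => ?_⟩
  rcases le_or_gt 2 a with h2 | h2
  · suffices h : {x : ℝ | 0 < x ∧ ∃ r : ℝ, 0 < r ∧ r ≤ x / 20 ∧
        ENNReal.ofReal (a * r) < volume (E ∩ Metric.closedBall x r)} = ∅ by
      rw [h]; simp
    refine eq_empty_of_forall_notMem ?_
    rintro x ⟨-, r, hr, -, h⟩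
    have := h.trans_le (measure_mono inter_subset_right)
    rw [Real.volume_closedBall, ENNReal.ofReal_lt_ofReal_iff (by positivity)] at this
    nlinarith
  · have h1 : a ^ p ≤ 2 ^ (p - 1) * a := by
      calc a ^ p = a ^ (p - 1) * a := by rw [Real.rpow_sub_one ha.ne', div_mul_cancel₀ _ ha.ne']
        _ ≤ _ := by gcongr
    calc _ ≤ ENNReal.ofReal (2 ^ (p - 1) * a) * _ := by gcongr
      _ = ENNReal.ofReal (2 ^ (p - 1)) * (ENNReal.ofReal a * _) := by
          rw [ENNReal.ofReal_mul (by positivity), mul_assoc]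
      _ ≤ ENNReal.ofReal (2 ^ (p - 1)) * (C * powMeasure δ E) := mul_le_mul_right (hC E hE a ha) _
      _ = _ := by rw [← mul_assoc, ENNReal.coe_mul]; rfl

end Local

section Sufficiency

lemma lintegral_indicator_rpow (a : ℝ) {K x : ℝ} (hK : 0 ≤ K) (hx : 0 < x) {G : Set ℝ}
    (hG : MeasurableSet G) :
    ∫⁻ y in Ioi 0, G.indicator (fun y => ENNReal.ofReal (K * (x ^ (-a) * y ^ (a - 1)))) y =
      ENNReal.ofReal K * (ENNReal.ofReal (x ^ (-a)) * powMeasure (a - 1) G) := by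
  rw [lintegral_indicator hG, powMeasure_apply, ← lintegral_const_mul _ (measurable_ofReal_rpow _),
    ← lintegral_const_mul _ ((measurable_ofReal_rpow _).const_mul _)]
  refine lintegral_congr fun y => ?_
  rw [ENNReal.ofReal_mul hK, ENNReal.ofReal_mul (by positivity)]

lemma ofReal_abs_WexoInt_le_lintegral {ν : ℝ} (hν : ν < 1) (E : Set ℝ) {t x : ℝ} (ht : 0 < t)
    (hx : 0 < x) :
    ENNReal.ofReal |WexoInt ν t (E.indicator 1) x| ≤
      ∫⁻ y in Ioi 0, E.indicator (fun y => ENNReal.ofReal (Wexo ν t x y * y ^ (2 * ν + 1))) y := by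
  unfold WexoInt
  rw [← Real.enorm_eq_ofReal_abs]
  refine (enorm_integral_le_lintegral_enorm _).trans ?_
  unfold etaMeasure
  rw [lintegral_withDensity_eq_lintegral_mul_non_measurable _ (measurable_ofReal_rpow _)
    (ae_of_all _ fun x => ENNReal.ofReal_lt_top)]
  refine setLIntegral_mono' measurableSet_Ioi fun y (hy : 0 < y) => ?_
  by_cases hyE : y ∈ E
  · rw [Pi.mul_apply, indicator_of_mem hyE, indicator_of_mem hyE, Pi.one_apply, mul_one,
      Real.enorm_eq_ofReal (Wexo_nonneg hν ht hx hy), ← ENNReal.ofReal_mul (by positivity),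
      mul_comm]
  · simp [hyE]

lemma exists_ofReal_abs_WexoInt_le {ν : ℝ} (hν : ν < 1) :
    ∃ K : ℝ, 0 < K ∧ ∀ E : Set ℝ, MeasurableSet E → ∀ t x : ℝ, 0 < t → 0 < x →
      ENNReal.ofReal |WexoInt ν t (E.indicator 1) x| ≤
        ENNReal.ofReal K *
          (ENNReal.ofReal (x ^ (-2 : ℝ)) * powMeasure (2 - 1) (E ∩ {y | y < 2 * x})) +
        ENNReal.ofReal K *
          (ENNReal.ofReal (x ^ (-(2 * ν))) * powMeasure (2 * ν - 1) (E ∩ {y | x < y})) +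
        ENNReal.ofReal K * ∫⁻ y in E ∩ Metric.closedBall x (x / 20),
          ENNReal.ofReal ((√t)⁻¹ * Real.exp (-((x - y) ^ 2 / (4 * t)))) := by
  obtain ⟨K, hK, h⟩ := exists_Wexo_le hν
  refine ⟨K, hK, fun E hE t x ht hx => (ofReal_abs_WexoInt_le_lintegral hν E ht hx).trans ?_⟩
  have m1 : MeasurableSet (E ∩ {y | y < 2 * x}) := hE.inter measurableSet_Iio
  have m2 : MeasurableSet (E ∩ {y | x < y}) := hE.inter measurableSet_Ioi
  have m3 : MeasurableSet (E ∩ Metric.closedBall x (x / 20)) :=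
    hE.inter Metric.isClosed_closedBall.measurableSet
  have hg : Measurable fun y : ℝ =>
      ENNReal.ofReal ((√t)⁻¹ * Real.exp (-((x - y) ^ 2 / (4 * t)))) := by fun_prop
  rw [← lintegral_indicator_rpow 2 hK.le hx m1, ← lintegral_indicator_rpow (2 * ν) hK.le hx m2]
  calc _ ≤ ∫⁻ y in Ioi 0,
      ((E ∩ {y | y < 2 * x}).indicator
          (fun y => ENNReal.ofReal (K * (x ^ (-2 : ℝ) * y ^ ((2 : ℝ) - 1)))) y +
        (E ∩ {y | x < y}).indicator
          (fun y => ENNReal.ofReal (K * (x ^ (-(2 * ν)) * y ^ (2 * ν - 1)))) y) +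
        ENNReal.ofReal K * (E ∩ Metric.closedBall x (x / 20)).indicator (fun y =>
          ENNReal.ofReal ((√t)⁻¹ * Real.exp (-((x - y) ^ 2 / (4 * t))))) y := by
        refine setLIntegral_mono' measurableSet_Ioi fun y (hy : 0 < y) => ?_
        by_cases hyE : y ∈ E
        · rw [indicator_of_mem hyE]
          rcases h t x y ht hx hy with ⟨hR, hb⟩ | ⟨hR, hb⟩ | ⟨hR, hb⟩
          · refine le_add_right (le_add_right ?_)
            rw [indicator_of_mem (show y ∈ E ∩ {y | y < 2 * x} from ⟨hyE, hR⟩)]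
            refine ENNReal.ofReal_le_ofReal (hb.trans_eq ?_)
            norm_num
          · refine le_add_right (le_add_left ?_)
            rw [indicator_of_mem (show y ∈ E ∩ {y | x < y} from ⟨hyE, hR⟩)]
            exact ENNReal.ofReal_le_ofReal hb
          · refine le_add_left ?_
            rw [indicator_of_mem (show y ∈ E ∩ Metric.closedBall x (x / 20) from
              ⟨hyE, by rwa [Metric.mem_closedBall, dist_comm, Real.dist_eq]⟩),
              ← ENNReal.ofReal_mul hK.le]
            exact ENNReal.ofReal_le_ofReal hb
        · simp [hyE]
    _ ≤ _ := by
        rw [lintegral_add_left, lintegral_add_left, lintegral_const_mul _ (hg.indicator m3),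
          lintegral_indicator m3]
        · gcongr
          exact Measure.restrict_le_self
        · exact Measurable.indicator (by fun_prop) m1
        · exact (Measurable.indicator (by fun_prop) m1).add
            (Measurable.indicator (by fun_prop) m2)

lemma ofReal_rpow_mul_le_of_div {μ : Measure ℝ} {S : Set ℝ} {c l p : ℝ} {D : ℝ≥0∞} (hc : 0 < c)
    (hl : 0 < l) (h : ENNReal.ofReal ((l / c) ^ p) * μ S ≤ D) :
    ENNReal.ofReal (l ^ p) * μ S ≤ ENNReal.ofReal (c ^ p) * D := by
  calc _ = ENNReal.ofReal (c ^ p) * (ENNReal.ofReal ((l / c) ^ p) * μ S) := by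
        rw [← mul_assoc, ← ENNReal.ofReal_mul (by positivity),
          ← Real.mul_rpow hc.le (by positivity), mul_div_cancel₀ _ hc.ne']
    _ ≤ _ := mul_le_mul_right h _

lemma exists_WexoMax_restricted_weak_type {ν δ p : ℝ} (hν0 : ν ≠ 0) (hν1 : ν < 1) (hp : 1 ≤ p)
    (h1 : 2 * ν * p - 1 ≤ δ) (h2 : δ ≤ 2 * p - 1) :
    ∃ C : ℝ≥0, ∀ E : Set ℝ, MeasurableSet E → powMeasure δ E < ⊤ → ∀ l : ℝ, 0 < l →
      ENNReal.ofReal (l ^ p) *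
          powMeasure δ {x | ENNReal.ofReal l < WexoMax ν (E.indicator 1) x} ≤
        C * powMeasure δ E := by
  obtain ⟨K, hK, hker⟩ := exists_ofReal_abs_WexoInt_le hν1
  obtain ⟨G, hG, hgauss⟩ := exists_gaussian_le
  obtain ⟨A, hA⟩ := exists_hardy_restricted_weak_type (a := 2) (p := p) (δ := δ)
    (c := 2 ^ (-(δ - 2 * p + 1))) two_ne_zero hp (by positivity) (R := fun x y => y < 2 * x)
    (measurableSet_lt measurable_snd (measurable_fst.const_mul 2))
    (fun _ x y hx hy hxy => by
      calc x ^ (δ - 2 * p + 1) ≤ (y / 2) ^ (δ - 2 * p + 1) :=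
            Real.rpow_le_rpow_of_nonpos (by positivity) (by linarith) (by linarith)
        _ = _ := by
            rw [Real.div_rpow hy.le two_pos.le, Real.rpow_neg two_pos.le, div_eq_inv_mul])
  obtain ⟨B, hB⟩ := exists_hardy_restricted_weak_type (a := 2 * ν) (p := p) (δ := δ)
    (c := 1) (mul_ne_zero two_ne_zero hν0) hp zero_le_one (R := fun x y => x < y)
    (measurableSet_lt measurable_fst measurable_snd)
    (fun _ x y hx hy hxy => by
      rw [one_mul]
      exact Real.rpow_le_rpow hx.le hxy.le (by linarith))
  obtain ⟨M, hM⟩ := exists_local_restricted_weak_type δ hp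
  refine ⟨((3 * K) ^ p).toNNReal * A + ((3 * K) ^ p).toNNReal * B +
    ((3 * K * G) ^ p).toNNReal * M, fun E hE hEf l hl => ?_⟩
  have eA := ofReal_rpow_mul_le_of_div (by positivity) hl
    (hA E hE hEf (l / (3 * K)) (by positivity))
  have eB := ofReal_rpow_mul_le_of_div (by positivity) hl
    (hB E hE hEf (l / (3 * K)) (by positivity))
  have eM := ofReal_rpow_mul_le_of_div (by positivity) hl
    (hM E hE (l / (3 * K * G)) (by positivity))
  set SA := {x : ℝ | 0 < x ∧ ENNReal.ofReal (l / (3 * K)) <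
    ENNReal.ofReal (x ^ (-2 : ℝ)) * powMeasure (2 - 1) (E ∩ {y | y < 2 * x})}
  set SB := {x : ℝ | 0 < x ∧ ENNReal.ofReal (l / (3 * K)) <
    ENNReal.ofReal (x ^ (-(2 * ν))) * powMeasure (2 * ν - 1) (E ∩ {y | x < y})}
  set SM := {x : ℝ | 0 < x ∧ ∃ r : ℝ, 0 < r ∧ r ≤ x / 20 ∧
    ENNReal.ofReal (l / (3 * K * G) * r) < volume (E ∩ Metric.closedBall x r)}
  have hsub : powMeasure δ {x | ENNReal.ofReal l < WexoMax ν (E.indicator 1) x} ≤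
      powMeasure δ (SA ∪ SB ∪ SM) := by
    refine powMeasure_mono fun x hx (hxl : ENNReal.ofReal l < WexoMax ν (E.indicator 1) x) => ?_
    by_contra hcon
    simp only [mem_union, not_or] at hcon
    obtain ⟨⟨nA, nB⟩, nM⟩ := hcon
    replace nA := not_lt.1 fun h => nA ⟨hx, h⟩
    replace nB := not_lt.1 fun h => nB ⟨hx, h⟩
    replace nM : ∀ r : ℝ, 0 < r → r ≤ x / 20 →
        volume (E ∩ Metric.closedBall x r) ≤ ENNReal.ofReal (l / (3 * K * G) * r) :=
      fun r h0 h1 => not_lt.1 fun h => nM ⟨hx, r, h0, h1, h⟩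
    refine absurd hxl (not_lt.2 (iSup₂_le fun t ht => ?_))
    have ht : 0 < t := ht
    have hgx := hgauss (E ∩ Metric.closedBall x (x / 20)) x (l / (3 * K * G)) (by positivity)
      (fun r hr => by
        rcases le_total r (x / 20) with h | h
        · exact (measure_mono (inter_subset_inter_left _ inter_subset_left)).trans (nM r hr h)
        · refine (measure_mono inter_subset_left).trans ((nM _ (by positivity) le_rfl).trans ?_)
          gcongr) t ht
    refine (hker E hE t x ht hx).trans ?_
    calc _ ≤ ENNReal.ofReal K * ENNReal.ofReal (l / (3 * K)) +
          ENNReal.ofReal K * ENNReal.ofReal (l / (3 * K)) +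
          ENNReal.ofReal K * ENNReal.ofReal (G * (l / (3 * K * G))) := by gcongr
      _ = ENNReal.ofReal l := by
          rw [← ENNReal.ofReal_mul hK.le, ← ENNReal.ofReal_mul hK.le,
            ← ENNReal.ofReal_add (by positivity) (by positivity),
            ← ENNReal.ofReal_add (by positivity) (by positivity)]
          congr 1; field_simp; norm_num
  calc _ ≤ ENNReal.ofReal (l ^ p) * (powMeasure δ SA + powMeasure δ SB + powMeasure δ SM) := by
        refine mul_le_mul_right (hsub.trans ((measure_union_le _ _).trans ?_)) _
        gcongr
        exact measure_union_le _ _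
    _ ≤ _ := by
        rw [mul_add, mul_add, ENNReal.coe_add, ENNReal.coe_add, ENNReal.coe_mul, ENNReal.coe_mul,
          ENNReal.coe_mul, add_mul, add_mul, mul_assoc, mul_assoc, mul_assoc]
        exact add_le_add (add_le_add eA eB) eM

end Sufficiency

section Necessity

lemma aemeasurable_besselI_comp {μ : ℝ} (hμ : -1 < μ) {c : ℝ} (hc : 0 < c) :
    AEMeasurable (fun y => besselI μ (c * y)) (volume.restrict (Ioi 0)) := by
  refine ⟨fun y => (∑' n : ℕ, ENNReal.ofReal ((c * y / 2) ^ (2 * (n : ℝ) + μ) /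
    (Real.Gamma ((n : ℝ) + 1) * Real.Gamma ((n : ℝ) + μ + 1)))).toReal, ?_, ?_⟩
  · exact (Measurable.tsum fun n => by fun_prop).ennreal_toReal
  · filter_upwards [ae_restrict_mem measurableSet_Ioi] with y hy
    have hw : 0 < c * y := mul_pos hc hy
    rw [← ENNReal.ofReal_tsum_of_nonneg (fun n => besselI_term_nonneg hμ hw n)
      (summable_besselI_and_le hμ hw).1]
    exact (ENNReal.toReal_ofReal (besselI_nonneg hμ hw)).symm

lemma aemeasurable_Wexo {ν : ℝ} (hν : ν < 1) {t x : ℝ} (ht : 0 < t) (hx : 0 < x) :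
    AEMeasurable (Wexo ν t x) (etaMeasure ν) := by
  refine AEMeasurable.mono_ac ?_ (withDensity_absolutelyContinuous _ _)
  have hb := aemeasurable_besselI_comp (μ := -ν) (by linarith) (by positivity : 0 < x / (2 * t))
  have he : Wexo ν t x = fun y => (x * y) ^ (-(2 * ν)) * ((2 * t)⁻¹ * (x * y) ^ (-(-ν)) *
      Real.exp (-(x ^ 2 + y ^ 2) / (4 * t)) * besselI (-ν) (x / (2 * t) * y)) := by
    funext y
    unfold Wexo Wcls
    rw [div_mul_eq_mul_div]
  rw [he]
  fun_prop

lemma lintegral_le_ofReal_abs_WexoInt {ν : ℝ} (hν : ν < 1) {t x : ℝ} (ht : 0 < t) (hx : 0 < x) :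
    ∫⁻ y in Icc 1 2, ENNReal.ofReal (Wexo ν t x y * y ^ (2 * ν + 1)) ≤
      ENNReal.ofReal |WexoInt ν t ((Icc 1 2).indicator 1) x| := by
  have hpos : 0 ≤ᵐ[etaMeasure ν] fun y => Wexo ν t x y * (Icc 1 2).indicator 1 y := by
    filter_upwards [(withDensity_absolutelyContinuous _ _).ae_le
      (ae_restrict_mem measurableSet_Ioi)] with y hy
    exact mul_nonneg (Wexo_nonneg hν ht hx hy) (indicator_nonneg (fun _ _ => zero_le_one) y)
  have hlint : ∫⁻ y, ENNReal.ofReal (Wexo ν t x y * (Icc 1 2).indicator 1 y) ∂(etaMeasure ν) =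
      ∫⁻ y in Icc 1 2, ENNReal.ofReal (Wexo ν t x y * y ^ (2 * ν + 1)) := by
    unfold etaMeasure
    rw [lintegral_withDensity_eq_lintegral_mul_non_measurable _ (measurable_ofReal_rpow _)
      (ae_of_all _ fun x => ENNReal.ofReal_lt_top),
      ← inter_eq_self_of_subset_left (s := Icc (1 : ℝ) 2) (t := Ioi 0)
        fun y hy => zero_lt_one.trans_le hy.1, ← Measure.restrict_restrict measurableSet_Icc,
      ← lintegral_indicator measurableSet_Icc]
    refine setLIntegral_congr_fun measurableSet_Ioi fun y (hy : 0 < y) => ?_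
    by_cases h : y ∈ Icc (1 : ℝ) 2
    · have h' : y ∈ Icc (1 : ℝ) 2 ∩ Ioi 0 := ⟨h, hy⟩
      simp only [Pi.mul_apply, indicator_of_mem h, indicator_of_mem h', Pi.one_apply, mul_one]
      rw [← ENNReal.ofReal_mul (by positivity), mul_comm]
    · simp [h]
  have hfin : ∫⁻ y in Icc 1 2, ENNReal.ofReal (Wexo ν t x y * y ^ (2 * ν + 1)) ≠ ⊤ := by
    obtain ⟨K, hK, h⟩ := exists_Wexo_le hν
    refine ((setLIntegral_mono (g := fun _ => ENNReal.ofReal (K * (x ^ (-2 : ℝ) * 2) +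
      K * (x ^ (-(2 * ν)) * 2 ^ |2 * ν - 1|) + K * ((√t)⁻¹ * 1))) measurable_const
      fun y hy => ENNReal.ofReal_le_ofReal ?_).trans_lt ?_).ne
    · have hy0 : 0 < y := zero_lt_one.trans_le hy.1
      have n1 : 0 ≤ K * (x ^ (-2 : ℝ) * 2) := by positivity
      have n2 : 0 ≤ K * (x ^ (-(2 * ν)) * 2 ^ |2 * ν - 1|) := by positivity
      have n3 : 0 ≤ K * ((√t)⁻¹ * 1) := by positivity
      rcases h t x y ht hx hy0 with ⟨-, hb⟩ | ⟨-, hb⟩ | ⟨-, hb⟩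
      · have : K * (x ^ (-2 : ℝ) * y) ≤ K * (x ^ (-2 : ℝ) * 2) := by gcongr; exact hy.2
        linarith
      · have : K * (x ^ (-(2 * ν)) * y ^ (2 * ν - 1)) ≤
            K * (x ^ (-(2 * ν)) * 2 ^ |2 * ν - 1|) := by
          gcongr
          exact rpow_le_two_rpow_abs (by linarith [hy.1]) hy.2 _
        linarith
      · have : K * ((√t)⁻¹ * Real.exp (-((x - y) ^ 2 / (4 * t)))) ≤ K * ((√t)⁻¹ * 1) := by
          gcongr
          rw [Real.exp_le_one_iff, neg_nonpos]
          positivity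
        linarith
    · rw [setLIntegral_const, Real.volume_Icc]
      exact ENNReal.mul_lt_top ENNReal.ofReal_lt_top ENNReal.ofReal_lt_top
  unfold WexoInt
  rw [integral_eq_lintegral_of_nonneg_ae hpos ((aemeasurable_Wexo hν ht hx).mul
    (measurable_one.indicator measurableSet_Icc).aemeasurable).aestronglyMeasurable, hlint,
    abs_of_nonneg ENNReal.toReal_nonneg, ENNReal.ofReal_toReal hfin]

lemma exists_le_WexoMax {ν : ℝ} (hν : ν < 1) :
    ∃ c : ℝ, 0 < c ∧ ∀ b x : ℝ, 0 < b → x ∈ Metric.closedBall b (b / 2) →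
      ENNReal.ofReal (c * b ^ (-(2 * ν)) * max 1 (b ^ 2) ^ (ν - 1)) ≤
        WexoMax ν ((Icc 1 2).indicator 1) x := by
  have hΓ : 0 < Real.Gamma (-ν + 1) := Real.Gamma_pos_of_pos (by linarith)
  refine ⟨(2 ^ |-(2 * ν)|)⁻¹ * (2⁻¹ * 4 ^ ν * Real.exp (-2) / Real.Gamma (-ν + 1)),
    by positivity, fun b x hb hxb => ?_⟩
  obtain ⟨hx, hx1, hx2⟩ := half_le_of_mem_closedBall hb hxb
  rw [le_div_iff₀ hb] at hx1
  rw [div_le_iff₀ hb] at hx2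
  set t := max 1 (b ^ 2) with htdef
  have ht1 : 1 ≤ t := le_max_left _ _
  have htb : b ^ 2 ≤ t := le_max_right _ _
  have ht : 0 < t := zero_lt_one.trans_le ht1
  refine le_trans ?_ (le_iSup₂_of_le t ht (lintegral_le_ofReal_abs_WexoInt hν ht hx))
  have hvol : volume (Icc (1 : ℝ) 2) = 1 := by rw [Real.volume_Icc]; norm_num
  rw [← mul_one (ENNReal.ofReal _), ← hvol, ← setLIntegral_const]
  refine setLIntegral_mono' measurableSet_Icc fun y hy => ENNReal.ofReal_le_ofReal ?_
  have hy0 : 0 < y := zero_lt_one.trans_le hy.1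
  have hbx : b ^ (-(2 * ν)) ≤ 2 ^ |-(2 * ν)| * x ^ (-(2 * ν)) := by
    have := rpow_le_two_rpow_abs (r := b / x) (by rw [le_div_iff₀ hx]; linarith)
      (by rw [div_le_iff₀ hx]; linarith) (-(2 * ν))
    rwa [Real.div_rpow hb.le hx.le, div_le_iff₀ (by positivity)] at this
  have hexp : Real.exp (-2) ≤ Real.exp (-(x ^ 2 + y ^ 2) / (4 * t)) := by
    refine Real.exp_le_exp.2 ?_
    rw [neg_div, neg_le_neg_iff, div_le_iff₀ (by positivity)]
    nlinarith [hy.2]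
  have hI := le_besselI (μ := -ν) (by linarith) (by positivity : 0 < x * y / (2 * t))
  have hI' : (x * y / (2 * t) / 2) ^ (-ν) = (4 * t) ^ ν * (x * y) ^ (-ν) := by
    rw [show x * y / (2 * t) / 2 = x * y / (4 * t) by field_simp; norm_num,
      Real.div_rpow (by positivity) (by positivity), Real.rpow_neg (by positivity : 0 ≤ 4 * t),
      div_inv_eq_mul, mul_comm]
  rw [Wexo_mul_rpow ν hx hy0]
  calc _ = (2 ^ |-(2 * ν)|)⁻¹ * b ^ (-(2 * ν)) * (2⁻¹ * 4 ^ ν * t ^ (ν - 1) * 1) *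
        Real.exp (-2) / Real.Gamma (-ν + 1) := by ring
    _ ≤ x ^ (-(2 * ν)) * (2⁻¹ * 4 ^ ν * t ^ (ν - 1) * y) *
        Real.exp (-(x ^ 2 + y ^ 2) / (4 * t)) / Real.Gamma (-ν + 1) := by
        gcongr
        · rwa [inv_mul_le_iff₀ (by positivity)]
        · exact hy.1
    _ = x ^ (-(2 * ν)) * (2 * t)⁻¹ * (x * y) ^ ν * y * Real.exp (-(x ^ 2 + y ^ 2) / (4 * t)) *
        ((4 * t) ^ ν * (x * y) ^ (-ν) / Real.Gamma (-ν + 1)) := by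
        rw [Real.mul_rpow (by norm_num) ht.le, Real.rpow_sub_one ht.ne',
          Real.rpow_neg (by positivity : 0 ≤ x * y)]
        have : (x * y) ^ ν ≠ 0 := by positivity
        field_simp
    _ ≤ _ := by rw [← hI']; gcongr

lemma nonpos_of_rpow_le {s D : ℝ} (h : ∀ b : ℝ, 1 ≤ b → b ^ s ≤ D) : s ≤ 0 := by
  by_contra! hs
  obtain ⟨b, hb, hb1⟩ := (((tendsto_rpow_atTop hs).eventually_gt_atTop D).and
    (Filter.eventually_ge_atTop 1)).exists
  exact (h b hb1).not_gt hb

lemma powMeasure_Icc_lt_top (δ : ℝ) : powMeasure δ (Icc 1 2) < ⊤ := by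
  have h := powMeasure_le_mul_volume δ two_pos measurableSet_Icc
    (show Icc (1 : ℝ) 2 ⊆ Metric.closedBall 2 (2 / 2) by
      rw [Real.closedBall_eq_Icc]
      exact Icc_subset_Icc (by norm_num) (by norm_num))
  rw [Real.volume_Icc] at h
  exact h.trans_lt (ENNReal.mul_lt_top ENNReal.ofReal_lt_top ENNReal.ofReal_lt_top)

lemma exists_rpow_mul_rpow_le {ν δ p : ℝ} (hν : ν < 1)
    (h : ∃ C : ℝ≥0, ∀ E : Set ℝ, MeasurableSet E → powMeasure δ E < ⊤ → ∀ l : ℝ, 0 < l →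
      ENNReal.ofReal (l ^ p) *
          powMeasure δ {x | ENNReal.ofReal l < WexoMax ν (E.indicator 1) x} ≤
        C * powMeasure δ E) :
    ∃ D : ℝ, ∀ b : ℝ, 0 < b →
      b ^ (δ + 1 - 2 * ν * p) * max 1 (b ^ 2) ^ ((ν - 1) * p) ≤ D := by
  obtain ⟨C, hC⟩ := h
  obtain ⟨c, hc, hlow⟩ := exists_le_WexoMax hν
  have hD : (C : ℝ≥0∞) * powMeasure δ (Icc 1 2) ≠ ⊤ :=
    (ENNReal.mul_lt_top ENNReal.coe_lt_top (powMeasure_Icc_lt_top δ)).ne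
  set D := ((C : ℝ≥0∞) * powMeasure δ (Icc 1 2)).toReal
  refine ⟨((c / 2) ^ p)⁻¹ * (2 ^ |δ| * D), fun b hb => ?_⟩
  have ht : 0 < max 1 (b ^ 2) := zero_lt_one.trans_le (le_max_left _ _)
  set t := max 1 (b ^ 2)
  set l := c / 2 * b ^ (-(2 * ν)) * t ^ (ν - 1) with hl
  have hl0 : 0 < l := by positivity
  have hsub : Metric.closedBall b (b / 2) ⊆
      {x | ENNReal.ofReal l < WexoMax ν ((Icc 1 2).indicator 1) x} := fun x hx => by
    refine lt_of_lt_of_le ?_ (hlow b x hb hx)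
    rw [show c * b ^ (-(2 * ν)) * t ^ (ν - 1) = 2 * l by rw [hl]; ring,
      ENNReal.ofReal_lt_ofReal_iff (by positivity)]
    linarith
  have h1 := (mul_le_mul_right (measure_mono hsub) _).trans
    (hC _ measurableSet_Icc (powMeasure_Icc_lt_top δ) l hl0)
  rw [← ENNReal.ofReal_toReal hD] at h1
  have h2 := volume_le_mul_powMeasure δ hb Metric.isClosed_closedBall.measurableSet
    (Subset.refl (Metric.closedBall b (b / 2)))
  rw [Real.volume_closedBall] at h2
  have h3 : ENNReal.ofReal (l ^ p * b) ≤ ENNReal.ofReal (2 ^ |δ| * b ^ (-δ) * D) := by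
    calc _ = ENNReal.ofReal (l ^ p) * ENNReal.ofReal (2 * (b / 2)) := by
          rw [← ENNReal.ofReal_mul (by positivity)]; congr 1; ring
      _ ≤ _ := mul_le_mul_right h2 _
      _ = ENNReal.ofReal (2 ^ |δ| * b ^ (-δ)) *
          (ENNReal.ofReal (l ^ p) * powMeasure δ (Metric.closedBall b (b / 2))) :=
          mul_left_comm _ _ _
      _ ≤ _ := mul_le_mul_right h1 _
      _ = _ := (ENNReal.ofReal_mul (by positivity)).symm
  rw [ENNReal.ofReal_le_ofReal_iff
    (mul_nonneg (by positivity) ENNReal.toReal_nonneg)] at h3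
  have h4 : l ^ p = (c / 2) ^ p * b ^ (-(2 * ν * p)) * t ^ ((ν - 1) * p) := by
    rw [hl, Real.mul_rpow (by positivity) (by positivity),
      Real.mul_rpow (by positivity) (by positivity), ← Real.rpow_mul hb.le,
      ← Real.rpow_mul ht.le, neg_mul]
  rw [le_inv_mul_iff₀ (by positivity)]
  calc _ = l ^ p * b * b ^ δ := by
        rw [h4, show δ + 1 - 2 * ν * p = -(2 * ν * p) + 1 + δ by ring, Real.rpow_add hb,
          Real.rpow_add hb, Real.rpow_one]
        ring
    _ ≤ 2 ^ |δ| * b ^ (-δ) * D * b ^ δ := by gcongr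
    _ = _ := by
        rw [Real.rpow_neg hb.le]
        field_simp

end Necessity

theorem stmt14 (ν δ p : ℝ) (hν0 : ν ≠ 0) (hν1 : ν < 1) (hp : 1 ≤ p) :
    (∃ C : ℝ≥0, ∀ E : Set ℝ, MeasurableSet E → powMeasure δ E < ⊤ → ∀ l : ℝ, 0 < l →
        ENNReal.ofReal (l ^ p) *
            powMeasure δ {x | ENNReal.ofReal l < WexoMax ν (E.indicator 1) x} ≤
          C * powMeasure δ E) ↔
      (2 * ν * p - 1 ≤ δ ∧ δ ≤ 2 * p - 1) := by
  refine ⟨fun h => ?_, fun h => exists_WexoMax_restricted_weak_type hν0 hν1 hp h.1 h.2⟩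
  obtain ⟨D, hD⟩ := exists_rpow_mul_rpow_le hν1 h
  constructor
  · suffices -(δ + 1 - 2 * ν * p) ≤ 0 by linarith
    refine nonpos_of_rpow_le (D := D) fun b hb => ?_
    have hb0 : 0 < b := by linarith
    have := hD b⁻¹ (by positivity)
    rwa [max_eq_left (pow_le_one₀ (by positivity) (inv_le_one_of_one_le₀ hb)), Real.one_rpow,
      mul_one, Real.inv_rpow hb0.le, ← Real.rpow_neg hb0.le] at this
  · suffices δ + 1 - 2 * p ≤ 0 by linarith
    refine nonpos_of_rpow_le (D := D) fun b hb => ?_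
    have hb0 : 0 < b := by linarith
    have := hD b hb0
    rw [max_eq_right (one_le_pow₀ hb), ← Real.rpow_natCast, ← Real.rpow_mul hb0.le,
      ← Real.rpow_add hb0] at this
    convert this using 2
    push_cast; ring

end
end

section
/- For each ν < 1 there exist constants C > 0 and c > 0 such that for all t, x, y > 0: W̃_t^ν(x,y) ≤ C x^{−2} y^{−2ν} if y ≤ x/2; W̃_t^ν(x,y) ≤ C ( (xy)^{−ν−1} + t^{−1/2} (xy)^{−ν−1/2} e^{−(x−y)²/(4t)} ) if x/2 < y < 2x; and W̃_t^ν(x,y) ≤ C x^{−2ν} y^{−2} (y²/t)^{−ν+1} e^{−c y²/t} if y ≥ 2x. Moreover, there exists c' > 0 such that W̃_t^ν(x,y) ≥ c' t^{ν−1} (xy)^{−2ν} e^{−(x²+y²)/(4t)} whenever xy < t, and W̃_t^ν(x,y) ≥ c' t^{−1/2} (xy)^{−ν−1/2} e^{−(x−y)²/(4t)} whenever xy > t. -/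
open MeasureTheory Set ENNReal
open scoped NNReal

noncomputable section

/-- `Γ(n+s)` is comparable with `n! (n+1)^(s-1)`, uniformly in `n`. -/
theorem exists_Gamma_nat_add_bounds {s : ℝ} (hs : 0 < s) :
    ∃ c : ℝ, 0 < c ∧ ∃ C : ℝ, 0 < C ∧ ∀ n : ℕ,
      c * ((n.factorial : ℝ) * ((n : ℝ) + 1) ^ (s - 1)) ≤ Real.Gamma ((n : ℝ) + s) ∧
        Real.Gamma ((n : ℝ) + s) ≤ C * ((n.factorial : ℝ) * ((n : ℝ) + 1) ^ (s - 1)) := by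
  have hΓ : 0 < Real.Gamma s := Real.Gamma_pos_of_pos hs
  have hΓn (n : ℕ) : 0 < Real.Gamma ((n : ℝ) + s) := Real.Gamma_pos_of_pos (by positivity)
  have hprod (n : ℕ) :
      ∏ j ∈ Finset.range n, (s + (j : ℝ)) = Real.Gamma ((n : ℝ) + s) / Real.Gamma s := by
    induction n with
    | zero => simp [hΓ.ne']
    | succ n ih =>
      rw [Finset.prod_range_succ, ih]
      have h : ((n + 1 : ℕ) : ℝ) + s = ((n : ℝ) + s) + 1 := by push_cast; ring
      rw [h, Real.Gamma_add_one (by positivity)]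
      ring
  set f : ℕ → ℝ := fun n =>
    (n.factorial : ℝ) * ((n : ℝ) + 1) ^ (s - 1) / Real.Gamma ((n : ℝ) + s) with hf
  have hfpos (n : ℕ) : 0 < f n := by have := hΓn n; simp only [hf]; positivity
  have hinv : Filter.Tendsto (fun n : ℕ => 1 / (n : ℝ)) Filter.atTop (nhds 0) :=
    tendsto_one_div_atTop_nhds_zero_nat
  have hA : Filter.Tendsto (fun n : ℕ => (1 + 1 / (n : ℝ)) ^ s) Filter.atTop (nhds 1) := by
    have h := (hinv.const_add 1).rpow_const (p := s) (Or.inr hs.le)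
    simpa using h
  have hB : Filter.Tendsto (fun n : ℕ => (1 + s * (1 / (n : ℝ))) / (1 + 1 / (n : ℝ)))
      Filter.atTop (nhds 1) := by
    have h := ((hinv.const_mul s).const_add 1).div (hinv.const_add 1) (by norm_num)
    simpa [Pi.div_def] using h
  have hlim : Filter.Tendsto f Filter.atTop (nhds 1) := by
    have h := (((Real.GammaSeq_tendsto_Gamma s).div_const (Real.Gamma s)).mul hA).mul hB
    rw [div_self hΓ.ne', one_mul, one_mul] at h
    refine h.congr' ?_
    filter_upwards [Filter.eventually_gt_atTop 0] with n hn
    have hn' : (0 : ℝ) < n := by exact_mod_cast hn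
    have hG := hΓn n
    have h1 : ((n + 1 : ℕ) : ℝ) + s = ((n : ℝ) + s) + 1 := by push_cast; ring
    have h2 : 1 + 1 / (n : ℝ) = ((n : ℝ) + 1) / n := by field_simp
    simp only [hf, Real.GammaSeq]
    rw [hprod, h1, Real.Gamma_add_one (by positivity), h2,
      Real.div_rpow (by positivity) (by positivity), Real.rpow_sub_one (by positivity)]
    have h3 : (0 : ℝ) < (n : ℝ) ^ s := by positivity
    field_simp
  obtain ⟨M, hM⟩ := hlim.bddAbove_range
  obtain ⟨m, hm⟩ := (hlim.inv₀ one_ne_zero).bddAbove_range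
  have hM' (n : ℕ) : f n ≤ M := hM ⟨n, rfl⟩
  have hm' (n : ℕ) : (f n)⁻¹ ≤ m := hm ⟨n, rfl⟩
  have hMpos : 0 < M := (hfpos 0).trans_le (hM' 0)
  have hmpos : 0 < m := (inv_pos.2 (hfpos 0)).trans_le (hm' 0)
  refine ⟨M⁻¹, inv_pos.2 hMpos, m, hmpos, fun n => ⟨?_, ?_⟩⟩
  · have h := hM' n
    simp only [hf] at h
    rw [div_le_iff₀ (hΓn n)] at h
    rw [inv_mul_le_iff₀ hMpos]
    exact h
  · have h := hm' n
    simp only [hf, inv_div] at h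
    rwa [div_le_iff₀ (by positivity)] at h

/-- Subseries of the exponential series are dominated by the exponential. -/
theorem summable_and_tsum_pow_div_factorial_le {x : ℝ} (hx : 0 ≤ x) {g : ℕ → ℕ}
    (hg : Function.Injective g) :
    Summable (fun n => x ^ g n / ((g n).factorial : ℝ)) ∧
      ∑' n, x ^ g n / ((g n).factorial : ℝ) ≤ Real.exp x := by
  have hs := Real.summable_pow_div_factorial x
  have hexp : ∑' n : ℕ, x ^ n / (n.factorial : ℝ) = Real.exp x := by
    rw [Real.exp_eq_exp_ℝ]
    exact (NormedSpace.expSeries_div_hasSum_exp x).tsum_eq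
  refine ⟨hs.comp_injective hg, ?_⟩
  rw [← hexp]
  exact tsum_comp_le_tsum_of_inj hs (fun n => by positivity) hg

theorem rpow_le_pow_add_factorial_mul_exp {r β : ℝ} (hr : 0 < r) {K : ℕ} (hK : |β| ≤ K) :
    r ^ β ≤ r ^ K + (K.factorial : ℝ) * Real.exp (1 / r) := by
  rcases le_total 1 r with h | h
  · have h1 : r ^ β ≤ r ^ K := by
      rw [← Real.rpow_natCast]
      exact Real.rpow_le_rpow_of_exponent_le h ((le_abs_self β).trans hK)
    have : 0 ≤ (K.factorial : ℝ) * Real.exp (1 / r) := by positivity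
    linarith
  · have h1 : r ^ β ≤ (1 / r) ^ K := by
      have h2 : r ^ β = (1 / r) ^ (-β) := by
        rw [one_div, Real.inv_rpow hr.le, Real.rpow_neg hr.le, inv_inv]
      rw [h2, ← Real.rpow_natCast]
      exact Real.rpow_le_rpow_of_exponent_le ((one_le_div hr).2 h) ((neg_le_abs β).trans hK)
    have h2 := Real.pow_div_factorial_le_exp (1 / r) (by positivity) K
    rw [div_le_iff₀ (by positivity)] at h2
    have : 0 ≤ r ^ K := by positivity
    linarith

/-- The terms of the hyperbolic sine series weighted by a power of `w/(n+1)`. -/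
def sinhTerm (β w : ℝ) (n : ℕ) : ℝ :=
  w ^ (2 * n + 1) / ((2 * n + 1).factorial : ℝ) * (w / ((n : ℝ) + 1)) ^ β

theorem sinhTerm_pos (β : ℝ) {w : ℝ} (hw : 0 < w) (n : ℕ) : 0 < sinhTerm β w n := by
  unfold sinhTerm
  positivity

theorem sinhTerm_le {β w : ℝ} (hw : 0 < w) {K : ℕ} (hK : |β| ≤ K) (n : ℕ) :
    sinhTerm β w n ≤
      ((K : ℝ) + 2) ^ K * (w ^ (2 * n + 1 + K) / ((2 * n + 1 + K).factorial : ℝ)) +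
        (K.factorial : ℝ) *
          ((w * Real.exp (1 / w)) ^ (2 * n + 1) / ((2 * n + 1).factorial : ℝ)) := by
  have hr : 0 < w / ((n : ℝ) + 1) := by positivity
  have h1 := rpow_le_pow_add_factorial_mul_exp hr hK
  have h2 : Real.exp (1 / (w / ((n : ℝ) + 1))) ≤ Real.exp (1 / w) ^ (2 * n + 1) := by
    rw [← Real.exp_nat_mul]
    apply Real.exp_le_exp.2
    push_cast
    rw [one_div_div, mul_one_div]
    gcongr
    have : (0 : ℝ) ≤ n := n.cast_nonneg
    linarith
  have h3 : ((2 * n + 1 + K).factorial : ℝ) ≤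
      ((2 * n + 1).factorial : ℝ) * (((K : ℝ) + 2) * ((n : ℝ) + 1)) ^ K := by
    have h := Nat.ascFactorial_le_pow_add (2 * n + 1) K
    have h' : (2 * n + 1 + K) ^ K ≤ ((K + 2) * (n + 1)) ^ K := by
      apply Nat.pow_le_pow_left
      nlinarith [Nat.zero_le (K * n)]
    rw [← Nat.factorial_mul_ascFactorial]
    exact_mod_cast Nat.mul_le_mul_left _ (h.trans h')
  have h4 : w ^ (2 * n + 1) / ((2 * n + 1).factorial : ℝ) * (w / ((n : ℝ) + 1)) ^ K ≤
      ((K : ℝ) + 2) ^ K * (w ^ (2 * n + 1 + K) / ((2 * n + 1 + K).factorial : ℝ)) := by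
    rw [div_pow, div_mul_div_comm, ← pow_add, ← mul_div_assoc,
      div_le_div_iff₀ (by positivity) (by positivity)]
    calc w ^ (2 * n + 1 + K) * ((2 * n + 1 + K).factorial : ℝ)
        ≤ w ^ (2 * n + 1 + K) *
          (((2 * n + 1).factorial : ℝ) * (((K : ℝ) + 2) * ((n : ℝ) + 1)) ^ K) := by gcongr
      _ = _ := by rw [mul_pow]; ring
  calc sinhTerm β w n
      ≤ w ^ (2 * n + 1) / ((2 * n + 1).factorial : ℝ) * ((w / ((n : ℝ) + 1)) ^ K +
          (K.factorial : ℝ) * Real.exp (1 / w) ^ (2 * n + 1)) := by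
        unfold sinhTerm
        gcongr
        refine h1.trans ?_
        gcongr
    _ = w ^ (2 * n + 1) / ((2 * n + 1).factorial : ℝ) * (w / ((n : ℝ) + 1)) ^ K +
        (K.factorial : ℝ) *
          ((w * Real.exp (1 / w)) ^ (2 * n + 1) / ((2 * n + 1).factorial : ℝ)) := by
        rw [mul_pow]; ring
    _ ≤ _ := by gcongr

theorem mul_exp_one_div_le {w : ℝ} (hw : 0 < w) :
    w * Real.exp (1 / w) ≤ w + Real.exp (1 / w) := by
  have h := Real.add_one_le_exp (-(1 / w))
  have h2 : Real.exp (-(1 / w)) * Real.exp (1 / w) = 1 := by rw [← Real.exp_add]; simp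
  have h3 : (-(1 / w) + 1) * Real.exp (1 / w) ≤ 1 :=
    (mul_le_mul_of_nonneg_right h (Real.exp_pos _).le).trans_eq h2
  have h4 := mul_le_mul_of_nonneg_left h3 hw.le
  have h5 : w * ((-(1 / w) + 1) * Real.exp (1 / w)) =
      -Real.exp (1 / w) + w * Real.exp (1 / w) := by field_simp
  linarith

theorem summable_sinhTerm (β : ℝ) {w : ℝ} (hw : 0 < w) : Summable (sinhTerm β w) := by
  obtain ⟨K, hK⟩ := exists_nat_ge |β|
  have h1 := (summable_and_tsum_pow_div_factorial_le hw.le (g := fun n => 2 * n + 1 + K)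
    (fun a b h => by simp only at h; omega)).1
  have h2 := (summable_and_tsum_pow_div_factorial_le (x := w * Real.exp (1 / w)) (by positivity)
    (g := fun n => 2 * n + 1) (fun a b h => by simp only at h; omega)).1
  exact Summable.of_nonneg_of_le (fun n => (sinhTerm_pos β hw n).le) (sinhTerm_le hw hK)
    ((h1.mul_left _).add (h2.mul_left _))

theorem exists_tsum_sinhTerm_le (β : ℝ) :
    ∃ C : ℝ, 0 < C ∧ ∀ w : ℝ, 1 / 2 ≤ w → ∑' n, sinhTerm β w n ≤ C * Real.exp w := by
  obtain ⟨K, hK⟩ := exists_nat_ge |β|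
  refine ⟨((K : ℝ) + 2) ^ K + (K.factorial : ℝ) * Real.exp (Real.exp 2), by positivity,
    fun w hw' => ?_⟩
  have hw : 0 < w := by linarith
  obtain ⟨s1, t1⟩ := summable_and_tsum_pow_div_factorial_le hw.le (g := fun n => 2 * n + 1 + K)
    (fun a b h => by simp only at h; omega)
  obtain ⟨s2, t2⟩ := summable_and_tsum_pow_div_factorial_le (x := w * Real.exp (1 / w))
    (by positivity) (g := fun n => 2 * n + 1) (fun a b h => by simp only at h; omega)
  have h1 := (summable_sinhTerm β hw).tsum_le_tsum (sinhTerm_le hw hK)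
    ((s1.mul_left _).add (s2.mul_left _))
  rw [(s1.mul_left _).tsum_add (s2.mul_left _), tsum_mul_left, tsum_mul_left] at h1
  have h2 : Real.exp (w * Real.exp (1 / w)) ≤ Real.exp (Real.exp 2) * Real.exp w := by
    rw [← Real.exp_add]
    apply Real.exp_le_exp.2
    have h3 : Real.exp (1 / w) ≤ Real.exp 2 := by
      apply Real.exp_le_exp.2
      rw [div_le_iff₀ hw]
      linarith
    linarith [mul_exp_one_div_le hw]
  calc ∑' n, sinhTerm β w n ≤ _ := h1
    _ ≤ ((K : ℝ) + 2) ^ K * Real.exp w +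
        (K.factorial : ℝ) * (Real.exp (Real.exp 2) * Real.exp w) := by
      gcongr
      exact t2.trans h2
    _ = _ := by ring

theorem exists_le_tsum_sinhTerm (β : ℝ) :
    ∃ c : ℝ, 0 < c ∧ ∀ w : ℝ, 1 / 2 ≤ w → c * Real.exp w ≤ ∑' n, sinhTerm β w n := by
  obtain ⟨C, hC, hle⟩ := exists_tsum_sinhTerm_le (-β)
  refine ⟨1 / (16 * C), by positivity, fun w hw' => ?_⟩
  have hw : 0 < w := by linarith
  set δ : ℝ := 1 / (4 * C) with hδ
  have hδpos : 0 < δ := by positivity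
  have hs := Real.hasSum_sinh w
  have hpt (n : ℕ) : 2 * δ * (w ^ (2 * n + 1) / ((2 * n + 1).factorial : ℝ)) ≤
      sinhTerm β w n + δ ^ 2 * sinhTerm (-β) w n := by
    have hr : 0 < w / ((n : ℝ) + 1) := by positivity
    unfold sinhTerm
    rw [Real.rpow_neg hr.le]
    set u := (w / ((n : ℝ) + 1)) ^ β with hu
    have hupos : 0 < u := by positivity
    have h : 2 * δ ≤ u + δ ^ 2 * u⁻¹ := by
      have h' : u + δ ^ 2 * u⁻¹ - 2 * δ = (u - δ) ^ 2 / u := by field_simp; ring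
      have : 0 ≤ (u - δ) ^ 2 / u := by positivity
      linarith
    have ha : 0 ≤ w ^ (2 * n + 1) / ((2 * n + 1).factorial : ℝ) := by positivity
    nlinarith [mul_le_mul_of_nonneg_left h ha]
  have s1 := summable_sinhTerm β hw
  have s2 := (summable_sinhTerm (-β) hw).mul_left (δ ^ 2)
  have h1 := (hs.summable.mul_left (2 * δ)).tsum_le_tsum hpt (s1.add s2)
  rw [s1.tsum_add s2, tsum_mul_left, tsum_mul_left, hs.tsum_eq] at h1
  have h2 : Real.exp w / 4 ≤ Real.sinh w := by
    rw [Real.sinh_eq]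
    have h3 : 2 * Real.exp (-w) ≤ Real.exp w := by
      have h4 : Real.exp w = Real.exp (2 * w) * Real.exp (-w) := by
        rw [← Real.exp_add]; congr 1; ring
      rw [h4]
      gcongr
      linarith [Real.add_one_le_exp (2 * w)]
    linarith
  have h3 := mul_le_mul_of_nonneg_left h2 (by positivity : 0 ≤ 2 * δ)
  have h4 := mul_le_mul_of_nonneg_left (hle w hw') (by positivity : 0 ≤ δ ^ 2)
  have h5 : 2 * δ * (Real.exp w / 4) - δ ^ 2 * (C * Real.exp w) =
      1 / (16 * C) * Real.exp w := by
    rw [hδ]; field_simp; ring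
  linarith

/-- The terms of the series defining `besselI`. -/
def besselTerm (μ w : ℝ) (n : ℕ) : ℝ :=
  (w / 2) ^ (2 * (n : ℝ) + μ) / (Real.Gamma ((n : ℝ) + 1) * Real.Gamma ((n : ℝ) + μ + 1))

theorem besselTerm_pos {μ w : ℝ} (hμ : -1 < μ) (hw : 0 < w) (n : ℕ) : 0 < besselTerm μ w n := by
  have h0 : (0 : ℝ) ≤ n := n.cast_nonneg
  have h1 : 0 < Real.Gamma ((n : ℝ) + 1) := Real.Gamma_pos_of_pos (by linarith)
  have h2 : 0 < Real.Gamma ((n : ℝ) + μ + 1) := Real.Gamma_pos_of_pos (by linarith)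
  unfold besselTerm
  positivity

theorem exists_besselTerm_bounds {μ : ℝ} (hμ : -1 < μ) :
    ∃ c : ℝ, 0 < c ∧ ∃ C : ℝ, 0 < C ∧ ∀ w : ℝ, 0 < w → ∀ n : ℕ,
      c * (w ^ (-(1 / 2) : ℝ) * sinhTerm (μ - 1 / 2) w n) ≤ besselTerm μ w n ∧
        besselTerm μ w n ≤ C * (w ^ (-(1 / 2) : ℝ) * sinhTerm (μ - 1 / 2) w n) := by
  obtain ⟨c₁, hc₁, C₁, hC₁, h₁⟩ := exists_Gamma_nat_add_bounds (s := μ + 1) (by linarith)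
  obtain ⟨c₂, hc₂, C₂, hC₂, h₂⟩ := exists_Gamma_nat_add_bounds (s := 3 / 2) (by norm_num)
  have hπ : 0 < √Real.pi := Real.sqrt_pos.2 Real.pi_pos
  set κ : ℝ := 2 ^ (1 - μ) / √Real.pi with hκ
  have hκpos : 0 < κ := by positivity
  refine ⟨κ * (c₂ / C₁), by positivity, κ * (C₂ / c₁), by positivity, fun w hw n => ?_⟩
  have hn : (0 : ℝ) < (n : ℝ) + 1 := by positivity
  have hG : 0 < Real.Gamma ((n : ℝ) + (μ + 1)) := Real.Gamma_pos_of_pos (by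
    have : (0 : ℝ) ≤ n := n.cast_nonneg
    linarith)
  have hG' : 0 < Real.Gamma ((n : ℝ) + 3 / 2) := Real.Gamma_pos_of_pos (by positivity)
  have hdup : (n.factorial : ℝ) * Real.Gamma ((n : ℝ) + 3 / 2) =
      ((2 * n + 1).factorial : ℝ) * 2 ^ (-1 - 2 * (n : ℝ)) * √Real.pi := by
    have h := Real.Gamma_mul_Gamma_add_half ((n : ℝ) + 1)
    have e1 : (n : ℝ) + 1 + 1 / 2 = (n : ℝ) + 3 / 2 := by ring
    have e2 : 2 * ((n : ℝ) + 1) = ((2 * n + 1 : ℕ) : ℝ) + 1 := by push_cast; ring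
    have e3 : 1 - (((2 * n + 1 : ℕ) : ℝ) + 1) = -1 - 2 * (n : ℝ) := by push_cast; ring
    rwa [e1, e2, e3, Real.Gamma_nat_eq_factorial, Real.Gamma_nat_eq_factorial] at h
  set ρ : ℝ := Real.Gamma ((n : ℝ) + 3 / 2) * ((n : ℝ) + 1) ^ (μ - 1 / 2) /
    Real.Gamma ((n : ℝ) + (μ + 1)) with hρ
  have hpow : ((n : ℝ) + 1) ^ (μ + 1 - 1) =
      ((n : ℝ) + 1) ^ ((3 : ℝ) / 2 - 1) * ((n : ℝ) + 1) ^ (μ - 1 / 2) := by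
    rw [← Real.rpow_add hn]; congr 1; ring
  have hρ_lower : c₂ / C₁ ≤ ρ := by
    rw [hρ, div_le_div_iff₀ hC₁ hG]
    calc c₂ * Real.Gamma ((n : ℝ) + (μ + 1))
        ≤ c₂ * (C₁ * ((n.factorial : ℝ) * ((n : ℝ) + 1) ^ (μ + 1 - 1))) := by
          gcongr; exact (h₁ n).2
      _ = (c₂ * ((n.factorial : ℝ) * ((n : ℝ) + 1) ^ ((3 : ℝ) / 2 - 1))) *
            ((n : ℝ) + 1) ^ (μ - 1 / 2) * C₁ := by rw [hpow]; ring
      _ ≤ _ := by gcongr; exact (h₂ n).1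
  have hρ_upper : ρ ≤ C₂ / c₁ := by
    rw [hρ, div_le_div_iff₀ hG hc₁]
    calc Real.Gamma ((n : ℝ) + 3 / 2) * ((n : ℝ) + 1) ^ (μ - 1 / 2) * c₁
        ≤ (C₂ * ((n.factorial : ℝ) * ((n : ℝ) + 1) ^ ((3 : ℝ) / 2 - 1))) *
            ((n : ℝ) + 1) ^ (μ - 1 / 2) * c₁ := by gcongr; exact (h₂ n).2
      _ = C₂ * (c₁ * ((n.factorial : ℝ) * ((n : ℝ) + 1) ^ (μ + 1 - 1))) := by rw [hpow]; ring
      _ ≤ _ := by gcongr; exact (h₁ n).1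
  have hterm : besselTerm μ w n =
      κ * ρ * (w ^ (-(1 / 2) : ℝ) * sinhTerm (μ - 1 / 2) w n) := by
    have e1 : (n : ℝ) + μ + 1 = (n : ℝ) + (μ + 1) := by ring
    have hfac : ((2 * n + 1).factorial : ℝ) = (n.factorial : ℝ) * Real.Gamma ((n : ℝ) + 3 / 2) /
        (2 ^ (-1 - 2 * (n : ℝ)) * √Real.pi) := by
      rw [hdup]; field_simp
    have hw2 : (w / 2) ^ (2 * (n : ℝ) + μ) =
        2 ^ (1 - μ) * 2 ^ (-1 - 2 * (n : ℝ)) *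
          (w ^ (-(1 / 2) : ℝ) * w ^ (2 * n + 1) * w ^ (μ - 1 / 2)) := by
      rw [Real.div_rpow hw.le zero_le_two, ← Real.rpow_natCast w, ← Real.rpow_add hw,
        ← Real.rpow_add hw, ← Real.rpow_add two_pos, div_eq_mul_inv,
        ← Real.rpow_neg zero_le_two, mul_comm]
      congr 2
      · ring
      · push_cast; ring
    unfold besselTerm sinhTerm
    rw [hfac, e1, Real.Gamma_nat_eq_factorial, hw2, Real.div_rpow hw.le hn.le, hκ, hρ]
    field_simp
  have hS := sinhTerm_pos (μ - 1 / 2) hw n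
  rw [hterm]
  constructor <;> gcongr

theorem summable_besselTerm {μ w : ℝ} (hμ : -1 < μ) (hw : 0 < w) : Summable (besselTerm μ w) := by
  obtain ⟨c, -, C, -, h⟩ := exists_besselTerm_bounds hμ
  exact Summable.of_nonneg_of_le (fun n => (besselTerm_pos hμ hw n).le) (fun n => (h w hw n).2)
    (((summable_sinhTerm _ hw).mul_left _).mul_left _)

/-- Two-sided bound of `I_μ(w)` by `w^(-1/2) e^w` away from the origin. -/
theorem exists_besselI_bounds_of_half_le {μ : ℝ} (hμ : -1 < μ) :
    ∃ c : ℝ, 0 < c ∧ ∃ C : ℝ, 0 < C ∧ ∀ w : ℝ, 1 / 2 ≤ w →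
      c * (w ^ (-(1 / 2) : ℝ) * Real.exp w) ≤ besselI μ w ∧
        besselI μ w ≤ C * (w ^ (-(1 / 2) : ℝ) * Real.exp w) := by
  obtain ⟨c, hc, C, hC, h⟩ := exists_besselTerm_bounds hμ
  obtain ⟨a, ha, hlow⟩ := exists_le_tsum_sinhTerm (μ - 1 / 2)
  obtain ⟨A, hA, hupp⟩ := exists_tsum_sinhTerm_le (μ - 1 / 2)
  refine ⟨c * a, by positivity, C * A, by positivity, fun w hw' => ?_⟩
  have hw : 0 < w := by linarith
  have hs := (summable_sinhTerm (μ - 1 / 2) hw).mul_left (w ^ (-(1 / 2) : ℝ))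
  have hb := summable_besselTerm hμ hw
  have h1 := (hs.mul_left c).tsum_le_tsum (fun n => (h w hw n).1) hb
  have h2 := hb.tsum_le_tsum (fun n => (h w hw n).2) (hs.mul_left C)
  rw [tsum_mul_left, tsum_mul_left] at h1 h2
  constructor
  · calc c * a * (w ^ (-(1 / 2) : ℝ) * Real.exp w)
        = c * (w ^ (-(1 / 2) : ℝ) * (a * Real.exp w)) := by ring
      _ ≤ c * (w ^ (-(1 / 2) : ℝ) * ∑' n, sinhTerm (μ - 1 / 2) w n) := by
        gcongr; exact hlow w hw'
      _ ≤ _ := h1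
  · calc besselI μ w ≤ C * (w ^ (-(1 / 2) : ℝ) * ∑' n, sinhTerm (μ - 1 / 2) w n) := h2
      _ ≤ C * (w ^ (-(1 / 2) : ℝ) * (A * Real.exp w)) := by
        gcongr; exact hupp w hw'
      _ = _ := by ring

theorem exists_mul_rpow_le_besselI {μ : ℝ} (hμ : -1 < μ) :
    ∃ c : ℝ, 0 < c ∧ ∀ w : ℝ, 0 < w → c * w ^ μ ≤ besselI μ w := by
  have hΓ : 0 < Real.Gamma (μ + 1) := Real.Gamma_pos_of_pos (by linarith)
  refine ⟨1 / (2 ^ μ * Real.Gamma (μ + 1)), by positivity, fun w hw => ?_⟩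
  have h := (summable_besselTerm hμ hw).le_tsum 0 (fun j _ => (besselTerm_pos hμ hw j).le)
  refine le_trans (le_of_eq ?_) h
  simp only [besselTerm, Nat.cast_zero, mul_zero, zero_add, Real.Gamma_one, one_mul]
  rw [Real.div_rpow hw.le zero_le_two]
  field_simp

theorem exists_besselI_le_rpow_of_le_half {μ : ℝ} (hμ : -1 < μ) :
    ∃ C : ℝ, 0 < C ∧ ∀ w : ℝ, 0 < w → w ≤ 1 / 2 → besselI μ w ≤ C * w ^ μ := by
  have hsum := summable_besselTerm hμ (w := 1 / 2) (by norm_num)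
  have hpos : 0 < ∑' n, besselTerm μ (1 / 2) n :=
    hsum.tsum_pos (fun n => (besselTerm_pos hμ (by norm_num) n).le) 0
      (besselTerm_pos hμ (by norm_num) 0)
  refine ⟨2 ^ μ * ∑' n, besselTerm μ (1 / 2) n, by positivity, fun w hw hw' => ?_⟩
  have hpt (n : ℕ) : besselTerm μ w n ≤ 2 ^ μ * w ^ μ * besselTerm μ (1 / 2) n := by
    have h0 : (0 : ℝ) ≤ n := n.cast_nonneg
    have h1 : 0 < Real.Gamma ((n : ℝ) + 1) := Real.Gamma_pos_of_pos (by linarith)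
    have h2 : 0 < Real.Gamma ((n : ℝ) + μ + 1) := Real.Gamma_pos_of_pos (by linarith)
    unfold besselTerm
    rw [← mul_div_assoc]
    gcongr
    have e : w / 2 = 2 * w * (1 / 2 / 2) := by ring
    rw [e, Real.mul_rpow (by positivity) (by norm_num), ← Real.mul_rpow zero_le_two hw.le]
    gcongr ?_ * _
    exact Real.rpow_le_rpow_of_exponent_ge (by positivity) (by linarith) (by linarith)
  have h := (summable_besselTerm hμ hw).tsum_le_tsum hpt (hsum.mul_left _)
  rw [tsum_mul_left] at h
  calc besselI μ w ≤ _ := h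
    _ = _ := by ring

/-- A global upper bound of `I_μ(w)` with a small exponential loss. -/
theorem exists_besselI_le_rpow_mul_exp {μ : ℝ} (hμ : -1 < μ) :
    ∃ C : ℝ, 0 < C ∧ ∀ w : ℝ, 0 < w → besselI μ w ≤ C * (w ^ μ * Real.exp (9 / 8 * w)) := by
  obtain ⟨C₁, hC₁, h₁⟩ := exists_besselI_le_rpow_of_le_half hμ
  obtain ⟨_, -, C₂, hC₂, h₂⟩ := exists_besselI_bounds_of_half_le hμ
  obtain ⟨K, hK⟩ := exists_nat_ge |-(1 / 2) - μ|
  set D : ℝ := 8 ^ K * (K.factorial : ℝ) + (K.factorial : ℝ) * Real.exp 2 with hD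
  have hDpos : 0 < D := by positivity
  refine ⟨C₁ + C₂ * D, by positivity, fun w hw => ?_⟩
  rcases le_total w (1 / 2) with hle | hge
  · calc besselI μ w ≤ C₁ * (w ^ μ * 1) := by rw [mul_one]; exact h₁ w hw hle
      _ ≤ C₁ * (w ^ μ * Real.exp (9 / 8 * w)) := by
        gcongr
        exact Real.one_le_exp (by positivity)
      _ ≤ _ := by
        gcongr
        linarith [mul_pos hC₂ hDpos]
  · have h3 : w ^ (-(1 / 2) - μ) ≤ D * Real.exp (w / 8) := by
      have h4 := rpow_le_pow_add_factorial_mul_exp hw hK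
      have h5 := Real.pow_div_factorial_le_exp (w / 8) (by positivity) K
      rw [div_le_iff₀ (by positivity), div_pow, div_le_iff₀ (by positivity)] at h5
      have h6 : Real.exp (1 / w) ≤ Real.exp 2 * Real.exp (w / 8) := by
        rw [← Real.exp_add]
        apply Real.exp_le_exp.2
        have : 1 / w ≤ 2 := by rw [div_le_iff₀ hw]; linarith
        linarith
      calc w ^ (-(1 / 2) - μ) ≤ _ := h4
        _ ≤ Real.exp (w / 8) * (K.factorial : ℝ) * 8 ^ K +
            (K.factorial : ℝ) * (Real.exp 2 * Real.exp (w / 8)) := by gcongr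
        _ = _ := by rw [hD]; ring
    have h7 : w ^ (-(1 / 2) : ℝ) = w ^ μ * w ^ (-(1 / 2) - μ) := by
      rw [← Real.rpow_add hw]; congr 1; ring
    calc besselI μ w ≤ C₂ * (w ^ (-(1 / 2) : ℝ) * Real.exp w) := (h₂ w hge).2
      _ ≤ C₂ * (w ^ μ * (D * Real.exp (w / 8)) * Real.exp w) := by rw [h7]; gcongr
      _ = C₂ * D * (w ^ μ * Real.exp (9 / 8 * w)) := by
        have : Real.exp (9 / 8 * w) = Real.exp (w / 8) * Real.exp w := by
          rw [← Real.exp_add]; congr 1; ring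
        rw [this]; ring
      _ ≤ _ := by gcongr; linarith

theorem exists_rpow_mul_exp_neg_le {p : ℝ} (hp : 0 ≤ p) :
    ∃ D : ℝ, 0 < D ∧ ∀ u : ℝ, 0 < u → u ^ p * Real.exp (-u / 32) ≤ D := by
  obtain ⟨K, hK⟩ := exists_nat_ge p
  refine ⟨1 + (K.factorial : ℝ) * 32 ^ K, by positivity, fun u hu => ?_⟩
  have h1 : u ^ p ≤ 1 + u ^ K := by
    rcases le_total u 1 with h | h
    · have := Real.rpow_le_one hu.le h hp
      have : 0 ≤ u ^ K := by positivity
      linarith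
    · have h2 := Real.rpow_le_rpow_of_exponent_le h hK
      rw [Real.rpow_natCast] at h2
      linarith
  have h2 := Real.pow_div_factorial_le_exp (u / 32) (by positivity) K
  rw [div_le_iff₀ (by positivity), div_pow, div_le_iff₀ (by positivity)] at h2
  have h3 : 1 ≤ Real.exp (u / 32) := Real.one_le_exp (by positivity)
  have h4 : Real.exp (u / 32) * Real.exp (-u / 32) = 1 := by
    rw [← Real.exp_add, ← Real.exp_zero]; congr 1; ring
  calc u ^ p * Real.exp (-u / 32)
      ≤ (Real.exp (u / 32) + Real.exp (u / 32) * (K.factorial : ℝ) * 32 ^ K) *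
          Real.exp (-u / 32) := by gcongr; linarith
    _ = (Real.exp (u / 32) * Real.exp (-u / 32)) * (1 + (K.factorial : ℝ) * 32 ^ K) := by ring
    _ = _ := by rw [h4, one_mul]

/-- The power factor of the exotic kernel, apart from the exponential and `I_{-ν}`. -/
def exoFactor (ν t z : ℝ) : ℝ :=
  z ^ (-(2 * ν)) * ((2 * t)⁻¹ * z ^ (- -ν))

theorem exoFactor_pos (ν : ℝ) {t z : ℝ} (ht : 0 < t) (hz : 0 < z) : 0 < exoFactor ν t z := by
  unfold exoFactor
  positivity

theorem Wexo_eq_exoFactor_mul (ν t x y : ℝ) :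
    Wexo ν t x y = exoFactor ν t (x * y) *
      (Real.exp (-(x ^ 2 + y ^ 2) / (4 * t)) * besselI (-ν) (x * y / (2 * t))) := by
  unfold Wexo Wcls exoFactor
  ring

theorem Wexo_comm (ν t x y : ℝ) : Wexo ν t x y = Wexo ν t y x := by
  simp only [Wexo_eq_exoFactor_mul, mul_comm x y, add_comm (x ^ 2)]

theorem exoFactor_mul_rpow_neg (ν : ℝ) {t z : ℝ} (ht : 0 < t) (hz : 0 < z) :
    exoFactor ν t z * (z / (2 * t)) ^ (-ν) = 2 ^ (ν - 1) * (t ^ (ν - 1) * z ^ (-(2 * ν))) := by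
  have h2t : (0 : ℝ) < 2 * t := by positivity
  unfold exoFactor
  rw [Real.div_rpow hz.le h2t.le, Real.rpow_neg hz.le (-ν), Real.rpow_neg h2t.le,
    ← mul_assoc (2 ^ (ν - 1)), ← Real.mul_rpow zero_le_two ht.le, Real.rpow_sub_one h2t.ne']
  have : 0 < z ^ (-ν) := by positivity
  field_simp

theorem exoFactor_mul_rpow_neg_half (ν : ℝ) {t z : ℝ} (ht : 0 < t) (hz : 0 < z) :
    exoFactor ν t z * (z / (2 * t)) ^ (-(1 / 2) : ℝ) =
      2 ^ (-(1 / 2) : ℝ) * (t ^ (-(1 / 2) : ℝ) * z ^ (-ν - 1 / 2)) := by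
  have h2t : (0 : ℝ) < 2 * t := by positivity
  have e1 : z ^ (-ν - 1 / 2) = z ^ (-(2 * ν)) * z ^ (- -ν) * z ^ (-(1 / 2) : ℝ) := by
    rw [← Real.rpow_add hz, ← Real.rpow_add hz]; congr 1; ring
  have e2 : (2 * t) ^ (-(1 / 2) : ℝ) * (2 * t) ^ (-(1 / 2) : ℝ) = (2 * t)⁻¹ := by
    rw [← Real.rpow_add h2t, ← Real.rpow_neg_one]; norm_num
  have h3 : 0 < (2 * t) ^ (-(1 / 2) : ℝ) := by positivity
  unfold exoFactor
  rw [Real.div_rpow hz.le h2t.le, ← mul_assoc (2 ^ (-(1 / 2) : ℝ)),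
    ← Real.mul_rpow zero_le_two ht.le, e1, ← e2]
  field_simp

theorem exp_mul_exp_eq {t : ℝ} (ht : 0 < t) (x y : ℝ) :
    Real.exp (-(x ^ 2 + y ^ 2) / (4 * t)) * Real.exp (x * y / (2 * t)) =
      Real.exp (-(x - y) ^ 2 / (4 * t)) := by
  rw [← Real.exp_add]
  congr 1
  field_simp
  ring

/-- Gaussian bound for the exotic kernel away from the diagonal. -/
theorem exists_Wexo_le_of_le_half {ν : ℝ} (hν : ν < 1) :
    ∃ C : ℝ, 0 < C ∧ ∀ t x y : ℝ, 0 < t → 0 < x → 0 < y → y ≤ x / 2 →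
      Wexo ν t x y ≤
        C * (t ^ (ν - 1) * (x * y) ^ (-(2 * ν))) * Real.exp (-(x ^ 2 / t) / 32) := by
  obtain ⟨C, hC, h⟩ := exists_besselI_le_rpow_mul_exp (μ := -ν) (by linarith)
  refine ⟨C * 2 ^ (ν - 1), by positivity, fun t x y ht hx hy hyx => ?_⟩
  have hz : 0 < x * y := by positivity
  have hP := exoFactor_pos ν ht hz
  have hexp : Real.exp (-(x ^ 2 + y ^ 2) / (4 * t)) * Real.exp (9 / 8 * (x * y / (2 * t))) ≤
      Real.exp (-(x ^ 2 / t) / 32) := by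
    rw [← Real.exp_add]
    apply Real.exp_le_exp.2
    have e : -(x ^ 2 / t) / 32 -
        (-(x ^ 2 + y ^ 2) / (4 * t) + 9 / 8 * (x * y / (2 * t))) =
        (7 * x - 4 * y) * (x - 2 * y) / (32 * t) := by field_simp; ring
    have : 0 ≤ (7 * x - 4 * y) * (x - 2 * y) / (32 * t) :=
      div_nonneg (mul_nonneg (by linarith) (by linarith)) (by positivity)
    linarith
  rw [Wexo_eq_exoFactor_mul]
  calc exoFactor ν t (x * y) *
        (Real.exp (-(x ^ 2 + y ^ 2) / (4 * t)) * besselI (-ν) (x * y / (2 * t)))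
      ≤ exoFactor ν t (x * y) * (Real.exp (-(x ^ 2 + y ^ 2) / (4 * t)) *
          (C * ((x * y / (2 * t)) ^ (-ν) * Real.exp (9 / 8 * (x * y / (2 * t)))))) := by
        gcongr
        exact h _ (by positivity)
    _ = C * (exoFactor ν t (x * y) * (x * y / (2 * t)) ^ (-ν)) *
          (Real.exp (-(x ^ 2 + y ^ 2) / (4 * t)) * Real.exp (9 / 8 * (x * y / (2 * t)))) := by
        ring
    _ ≤ C * (exoFactor ν t (x * y) * (x * y / (2 * t)) ^ (-ν)) *
          Real.exp (-(x ^ 2 / t) / 32) := by gcongr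
    _ = _ := by rw [exoFactor_mul_rpow_neg ν ht hz]; ring

theorem rpow_mul_rpow_sq_div (ν : ℝ) {t x y : ℝ} (ht : 0 < t) (hx : 0 < x) (hy : 0 < y) :
    y ^ (-2 : ℝ) * x ^ (-(2 * ν)) * (y ^ 2 / t) ^ (1 - ν) =
      t ^ (ν - 1) * (x * y) ^ (-(2 * ν)) := by
  have e : t ^ (ν - 1) = (t ^ (1 - ν))⁻¹ := by rw [← Real.rpow_neg ht.le]; congr 1; ring
  have e2 : (y ^ 2) ^ (1 - ν) = y ^ (2 - 2 * ν) := by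
    rw [← Real.rpow_natCast, ← Real.rpow_mul hy.le]; congr 1; push_cast; ring
  have e3 : y ^ (-(2 * ν)) = y ^ (-2 : ℝ) * y ^ (2 - 2 * ν) := by
    rw [← Real.rpow_add hy]; congr 1; ring
  rw [Real.div_rpow (by positivity) ht.le, e, e2, Real.mul_rpow hx.le hy.le, e3]
  ring

/-- Upper bound for the exotic kernel adapted to the region near the diagonal. -/
theorem exists_Wexo_le_near_diagonal {ν : ℝ} (hν : ν < 1) :
    ∃ C : ℝ, 0 < C ∧ ∀ t x y : ℝ, 0 < t → 0 < x → 0 < y →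
      Wexo ν t x y ≤ C * ((x * y) ^ (-ν - 1) +
        t ^ (-(1 / 2) : ℝ) * (x * y) ^ (-ν - 1 / 2) * Real.exp (-(x - y) ^ 2 / (4 * t))) := by
  obtain ⟨C₁, hC₁, h₁⟩ := exists_besselI_le_rpow_of_le_half (μ := -ν) (by linarith)
  obtain ⟨_, -, C₂, hC₂, h₂⟩ := exists_besselI_bounds_of_half_le (μ := -ν) (by linarith)
  refine ⟨C₁ * 2 ^ (ν - 1) + C₂ * 2 ^ (-(1 / 2) : ℝ), by positivity, fun t x y ht hx hy => ?_⟩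
  have hz : 0 < x * y := by positivity
  have hP := exoFactor_pos ν ht hz
  have hw : 0 < x * y / (2 * t) := by positivity
  rw [Wexo_eq_exoFactor_mul, mul_add]
  have n₁ : 0 ≤ (x * y) ^ (-ν - 1) := by positivity
  have n₂ : 0 ≤ t ^ (-(1 / 2) : ℝ) * (x * y) ^ (-ν - 1 / 2) *
    Real.exp (-(x - y) ^ 2 / (4 * t)) := by positivity
  have p₁ : 0 ≤ C₁ * (2 : ℝ) ^ (ν - 1) := by positivity
  have p₂ : 0 ≤ C₂ * (2 : ℝ) ^ (-(1 / 2) : ℝ) := by positivity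
  rcases le_total (x * y / (2 * t)) (1 / 2) with hle | hge
  · have hzt : x * y ≤ t := by
      rw [div_le_iff₀ (by positivity)] at hle
      linarith
    have key : exoFactor ν t (x * y) * (Real.exp (-(x ^ 2 + y ^ 2) / (4 * t)) *
        besselI (-ν) (x * y / (2 * t))) ≤ C₁ * 2 ^ (ν - 1) * (x * y) ^ (-ν - 1) := by
      calc _ ≤ exoFactor ν t (x * y) * (Real.exp (-(x ^ 2 + y ^ 2) / (4 * t)) *
            (C₁ * (x * y / (2 * t)) ^ (-ν))) := by
            gcongr
            exact h₁ _ hw hle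
        _ ≤ exoFactor ν t (x * y) * (1 * (C₁ * (x * y / (2 * t)) ^ (-ν))) := by
            gcongr
            exact Real.exp_le_one_iff.2 (by rw [neg_div, neg_nonpos]; positivity)
        _ = C₁ * (exoFactor ν t (x * y) * (x * y / (2 * t)) ^ (-ν)) := by ring
        _ = C₁ * 2 ^ (ν - 1) * (t ^ (ν - 1) * (x * y) ^ (-(2 * ν))) := by
            rw [exoFactor_mul_rpow_neg ν ht hz]; ring
        _ ≤ C₁ * 2 ^ (ν - 1) * ((x * y) ^ (ν - 1) * (x * y) ^ (-(2 * ν))) := by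
            gcongr C₁ * 2 ^ (ν - 1) * (?_ * _)
            exact Real.rpow_le_rpow_of_nonpos hz hzt (by linarith)
        _ = _ := by
            rw [← Real.rpow_add hz]; congr 2; ring
    linarith [mul_nonneg p₂ n₁, mul_nonneg p₁ n₂, mul_nonneg p₂ n₂]
  · have key : exoFactor ν t (x * y) * (Real.exp (-(x ^ 2 + y ^ 2) / (4 * t)) *
        besselI (-ν) (x * y / (2 * t))) ≤ C₂ * 2 ^ (-(1 / 2) : ℝ) *
          (t ^ (-(1 / 2) : ℝ) * (x * y) ^ (-ν - 1 / 2) *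
            Real.exp (-(x - y) ^ 2 / (4 * t))) := by
      calc _ ≤ exoFactor ν t (x * y) * (Real.exp (-(x ^ 2 + y ^ 2) / (4 * t)) *
            (C₂ * ((x * y / (2 * t)) ^ (-(1 / 2) : ℝ) * Real.exp (x * y / (2 * t))))) := by
            gcongr
            exact (h₂ _ hge).2
        _ = C₂ * (exoFactor ν t (x * y) * (x * y / (2 * t)) ^ (-(1 / 2) : ℝ)) *
            (Real.exp (-(x ^ 2 + y ^ 2) / (4 * t)) * Real.exp (x * y / (2 * t))) := by ring
        _ = _ := by rw [exoFactor_mul_rpow_neg_half ν ht hz, exp_mul_exp_eq ht]; ring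
    linarith [mul_nonneg p₁ n₁, mul_nonneg p₂ n₁, mul_nonneg p₁ n₂]

theorem exists_le_Wexo {ν : ℝ} (hν : ν < 1) :
    ∃ c : ℝ, 0 < c ∧ ∀ t x y : ℝ, 0 < t → 0 < x → 0 < y →
      c * t ^ (ν - 1) * (x * y) ^ (-(2 * ν)) * Real.exp (-(x ^ 2 + y ^ 2) / (4 * t)) ≤
        Wexo ν t x y := by
  obtain ⟨c, hc, h⟩ := exists_mul_rpow_le_besselI (μ := -ν) (by linarith)
  refine ⟨c * 2 ^ (ν - 1), by positivity, fun t x y ht hx hy => ?_⟩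
  have hz : 0 < x * y := by positivity
  have hP := exoFactor_pos ν ht hz
  rw [Wexo_eq_exoFactor_mul]
  calc _ = exoFactor ν t (x * y) * (Real.exp (-(x ^ 2 + y ^ 2) / (4 * t)) *
        (c * (x * y / (2 * t)) ^ (-ν))) := by
        linear_combination (-c * Real.exp (-(x ^ 2 + y ^ 2) / (4 * t))) *
          exoFactor_mul_rpow_neg ν ht hz
    _ ≤ _ := by gcongr; exact h _ (by positivity)

theorem exists_le_Wexo_of_lt_mul {ν : ℝ} (hν : ν < 1) :
    ∃ c : ℝ, 0 < c ∧ ∀ t x y : ℝ, 0 < t → 0 < x → 0 < y → t < x * y →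
      c * t ^ (-(1 / 2) : ℝ) * (x * y) ^ (-ν - 1 / 2) * Real.exp (-(x - y) ^ 2 / (4 * t)) ≤
        Wexo ν t x y := by
  obtain ⟨c, hc, _, -, h⟩ := exists_besselI_bounds_of_half_le (μ := -ν) (by linarith)
  refine ⟨c * 2 ^ (-(1 / 2) : ℝ), by positivity, fun t x y ht hx hy htz => ?_⟩
  have hz : 0 < x * y := by positivity
  have hP := exoFactor_pos ν ht hz
  have hw : 1 / 2 ≤ x * y / (2 * t) := by
    rw [le_div_iff₀ (by positivity)]; linarith
  rw [Wexo_eq_exoFactor_mul, ← exp_mul_exp_eq ht]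
  calc _ = exoFactor ν t (x * y) * (Real.exp (-(x ^ 2 + y ^ 2) / (4 * t)) *
        (c * ((x * y / (2 * t)) ^ (-(1 / 2) : ℝ) * Real.exp (x * y / (2 * t))))) := by
        linear_combination (-c * (Real.exp (-(x ^ 2 + y ^ 2) / (4 * t)) *
          Real.exp (x * y / (2 * t)))) * exoFactor_mul_rpow_neg_half ν ht hz
    _ ≤ _ := by gcongr; exact (h _ hw).1

theorem stmt15 (ν : ℝ) (hν : ν < 1) :
    (∃ C : ℝ, 0 < C ∧ ∃ c : ℝ, 0 < c ∧
      ∀ t x y : ℝ, 0 < t → 0 < x → 0 < y →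
        (y ≤ x / 2 → Wexo ν t x y ≤ C * x ^ (-2 : ℝ) * y ^ (-(2 * ν))) ∧
        (x / 2 < y → y < 2 * x →
          Wexo ν t x y ≤ C * ((x * y) ^ (-ν - 1) +
            t ^ (-(1/2) : ℝ) * (x * y) ^ (-ν - 1/2) * Real.exp (-(x - y) ^ 2 / (4 * t)))) ∧
        (2 * x ≤ y →
          Wexo ν t x y ≤
            C * x ^ (-(2 * ν)) * y ^ (-2 : ℝ) * (y ^ 2 / t) ^ (-ν + 1) *
              Real.exp (-(c * y ^ 2) / t))) ∧
    (∃ c' : ℝ, 0 < c' ∧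
      ∀ t x y : ℝ, 0 < t → 0 < x → 0 < y →
        (x * y < t →
          c' * t ^ (ν - 1) * (x * y) ^ (-(2 * ν)) * Real.exp (-(x ^ 2 + y ^ 2) / (4 * t)) ≤
            Wexo ν t x y) ∧
        (t < x * y →
          c' * t ^ (-(1/2) : ℝ) * (x * y) ^ (-ν - 1/2) * Real.exp (-(x - y) ^ 2 / (4 * t)) ≤
            Wexo ν t x y)) := by
  obtain ⟨A, hA, hoff⟩ := exists_Wexo_le_of_le_half hν
  obtain ⟨B, hB, hdiag⟩ := exists_Wexo_le_near_diagonal hν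
  obtain ⟨D, hD, hdecay⟩ := exists_rpow_mul_exp_neg_le (p := 1 - ν) (by linarith)
  obtain ⟨a, ha, hlow⟩ := exists_le_Wexo hν
  obtain ⟨b, hb, hlow'⟩ := exists_le_Wexo_of_lt_mul hν
  refine ⟨⟨A * D + B + A, by positivity, 1 / 32, by norm_num, fun t x y ht hx hy =>
    ⟨fun hyx => ?_, fun _ _ => ?_, fun hxy => ?_⟩⟩,
    ⟨min a b, lt_min ha hb, fun t x y ht hx hy => ⟨fun _ => ?_, fun htz => ?_⟩⟩⟩
  · calc Wexo ν t x y ≤ _ := hoff t x y ht hx hy hyx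
      _ = A * (x ^ (-2 : ℝ) * y ^ (-(2 * ν))) *
          ((x ^ 2 / t) ^ (1 - ν) * Real.exp (-(x ^ 2 / t) / 32)) := by
        rw [mul_comm x y, ← rpow_mul_rpow_sq_div ν ht hy hx]; ring
      _ ≤ A * (x ^ (-2 : ℝ) * y ^ (-(2 * ν))) * D := by
        gcongr
        exact hdecay _ (by positivity)
      _ = A * D * x ^ (-2 : ℝ) * y ^ (-(2 * ν)) := by ring
      _ ≤ _ := by
        gcongr
        linarith
  · refine (hdiag t x y ht hx hy).trans ?_
    gcongr
    linarith [mul_pos hA hD]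
  · have h := hoff t y x ht hy hx (by linarith)
    rw [Wexo_comm, mul_comm y x, ← rpow_mul_rpow_sq_div ν ht hx hy] at h
    have e : -(1 / 32 * y ^ 2) / t = -(y ^ 2 / t) / 32 := by ring
    rw [e, neg_add_eq_sub]
    calc Wexo ν t x y ≤ _ := h
      _ = A * x ^ (-(2 * ν)) * y ^ (-2 : ℝ) * (y ^ 2 / t) ^ (1 - ν) *
          Real.exp (-(y ^ 2 / t) / 32) := by ring
      _ ≤ _ := by
        gcongr
        linarith [mul_pos hA hD]
  · refine le_trans ?_ (hlow t x y ht hx hy)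
    gcongr
    exact min_le_left _ _
  · refine le_trans ?_ (hlow' t x y ht hx hy htz)
    gcongr
    exact min_le_right _ _

end
end

section
/- For all x, y > 0 with x ≠ y, the exotic Riesz transform kernel of order ν = 1/2 has the explicit form R̃_{1/2}(x,y) = (1/(π x y)) ( 1/(y−x) − 1/(y+x) − (1/x) log( y² / (|x−y|(x+y)) ) ). -/
open MeasureTheory Set ENNReal
open scoped NNReal

noncomputable section

/-- The classical Bessel heat kernel of order `-1/2`:
`W_t^{-1/2}(x,y) = (4πt)^{-1/2} ( e^{-(x-y)²/(4t)} + e^{-(x+y)²/(4t)} )`. -/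
def Wm (t x y : ℝ) : ℝ :=
  (4 * Real.pi * t) ^ (-(1/2) : ℝ) *
    (Real.exp (-(x - y) ^ 2 / (4 * t)) + Real.exp (-(x + y) ^ 2 / (4 * t)))

/-- Its boundary value `W_t^{-1/2}(0,y) = 2 (4πt)^{-1/2} e^{-y²/(4t)}`. -/
def Wm0 (t y : ℝ) : ℝ :=
  2 * (4 * Real.pi * t) ^ (-(1/2) : ℝ) * Real.exp (-y ^ 2 / (4 * t))

/-- The exotic Riesz transform kernel of order `ν = 1/2`:
`R̃_{1/2}(x,y) = (xy)^{-1} π^{-1/2}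
  ∫₀^∞ ( ∂ₓ W_t^{-1/2}(x,y) - x⁻¹ W_t^{-1/2}(x,y) + x⁻¹ W_t^{-1/2}(0,y) ) t^{-1/2} dt`. -/
def RieszHalf (x y : ℝ) : ℝ :=
  (x * y)⁻¹ * Real.pi ^ (-(1/2) : ℝ) *
    ∫ t in Ioi (0:ℝ),
      (deriv (fun u => Wm t u y) x - x⁻¹ * Wm t x y + x⁻¹ * Wm0 t y) * t ^ (-(1/2) : ℝ)

theorem integrableOn_exp_neg_div_div_sq {c : ℝ} (hc : 0 < c) :
    IntegrableOn (fun t : ℝ => (t ^ 2)⁻¹ * Real.exp (-c / t)) (Ioi 0) := by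
  have h := (integrableOn_Ioi_comp_rpow_iff' (fun s : ℝ => Real.exp (-c * s))
    (p := -1) (by norm_num)).2 (integrableOn_exp_mul_Ioi (neg_neg_of_pos hc) 0)
  refine h.congr_fun (fun t ht => ?_) measurableSet_Ioi
  have ht : (0 : ℝ) < t := ht
  simp only [smul_eq_mul]
  rw [show (-1 - 1 : ℝ) = -(2 : ℕ) by norm_num, Real.rpow_neg ht.le, Real.rpow_natCast,
    Real.rpow_neg_one, div_eq_mul_inv]

theorem integral_exp_neg_div_div_sq {c : ℝ} (hc : 0 < c) :
    ∫ t in Ioi (0 : ℝ), (t ^ 2)⁻¹ * Real.exp (-c / t) = c⁻¹ := by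
  have h := integral_comp_rpow_Ioi (fun s : ℝ => Real.exp (-c * s)) (p := -1) (by norm_num)
  rw [integral_exp_mul_Ioi (neg_neg_of_pos hc)] at h
  rw [show c⁻¹ = -Real.exp (-c * 0) / -c by simp, ← h]
  refine setIntegral_congr_fun measurableSet_Ioi (fun t ht => ?_)
  have ht : (0 : ℝ) < t := ht
  simp only [smul_eq_mul]
  rw [show (-1 - 1 : ℝ) = -(2 : ℕ) by norm_num, Real.rpow_neg ht.le, Real.rpow_natCast,
    Real.rpow_neg_one, div_eq_mul_inv, abs_neg, abs_one, one_mul]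

theorem integrableOn_inv_mul_exp_sub_exp_of_le {a b : ℝ} (ha : 0 < a) (hab : a ≤ b) :
    IntegrableOn (fun t : ℝ => t⁻¹ * (Real.exp (-a / t) - Real.exp (-b / t))) (Ioi 0) := by
  refine ((integrableOn_exp_neg_div_div_sq ha).const_mul (b - a)).mono'
    (Measurable.aestronglyMeasurable (by fun_prop)) ?_
  filter_upwards [ae_restrict_mem measurableSet_Ioi] with t (ht : 0 < t)
  have hexp : Real.exp (-b / t) = Real.exp (-a / t) * Real.exp (-((b - a) / t)) := by
    rw [← Real.exp_add]
    congr 1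
    ring
  have hle : Real.exp (-((b - a) / t)) ≤ 1 :=
    Real.exp_le_one_iff.2 (neg_nonpos.2 (div_nonneg (sub_nonneg.2 hab) ht.le))
  have hlow := Real.add_one_le_exp (-((b - a) / t))
  rw [hexp, show t⁻¹ * (Real.exp (-a / t) - Real.exp (-a / t) * Real.exp (-((b - a) / t)))
    = t⁻¹ * Real.exp (-a / t) * (1 - Real.exp (-((b - a) / t))) by ring,
    Real.norm_of_nonneg (mul_nonneg (by positivity) (sub_nonneg.2 hle))]
  calc t⁻¹ * Real.exp (-a / t) * (1 - Real.exp (-((b - a) / t)))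
      ≤ t⁻¹ * Real.exp (-a / t) * ((b - a) / t) := by
        gcongr
        linarith
    _ = (b - a) * ((t ^ 2)⁻¹ * Real.exp (-a / t)) := by
        field_simp

theorem integrableOn_inv_mul_exp_sub_exp {a b : ℝ} (ha : 0 < a) (hb : 0 < b) :
    IntegrableOn (fun t : ℝ => t⁻¹ * (Real.exp (-a / t) - Real.exp (-b / t))) (Ioi 0) := by
  rcases le_total a b with hab | hab
  · exact integrableOn_inv_mul_exp_sub_exp_of_le ha hab
  · refine (integrableOn_inv_mul_exp_sub_exp_of_le hb hab).neg.congr_fun (fun t _ => ?_)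
      measurableSet_Ioi
    simp only [Pi.neg_apply]
    ring

open Filter Topology in
theorem integral_inv_mul_exp_sub_exp {a b : ℝ} (ha : 0 < a) (hb : 0 < b) :
    ∫ t in Ioi (0 : ℝ), t⁻¹ * (Real.exp (-a / t) - Real.exp (-b / t)) = Real.log (b / a) := by
  have heq (c t : ℝ) : Real.exp (-(c⁻¹ * t)⁻¹) = Real.exp (-c / t) := by
    rw [mul_inv, inv_inv, neg_div, div_eq_mul_inv]
  have hf : LocallyIntegrableOn (fun t : ℝ => Real.exp (-t⁻¹)) (Ioi 0) :=
    ContinuousOn.locallyIntegrableOn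
      (Real.continuous_exp.comp_continuousOn
        (continuousOn_inv₀.mono fun t (ht : 0 < t) => ht.ne').neg) measurableSet_Ioi
  have hL : Tendsto (fun t : ℝ => Real.exp (-t⁻¹)) (𝓝[>] 0) (𝓝 0) :=
    Real.tendsto_exp_neg_atTop_nhds_zero.comp tendsto_inv_nhdsGT_zero
  have hR : Tendsto (fun t : ℝ => Real.exp (-t⁻¹)) atTop (𝓝 1) := by
    simpa [Function.comp_def] using
      (Real.continuous_exp.tendsto _).comp (tendsto_inv_atTop_zero (𝕜 := ℝ)).neg
  have h := Frullani.integral_Ioi_eq hf (inv_pos.2 ha) (inv_pos.2 hb) hL hR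
    (by simpa only [heq, smul_eq_mul] using integrableOn_inv_mul_exp_sub_exp ha hb)
  simp only [heq, smul_eq_mul] at h
  rw [h, zero_sub, mul_neg_one, ← Real.log_inv, inv_div, div_inv_eq_mul, mul_comm,
    div_eq_mul_inv]

theorem hasDerivAt_Wm (t x y : ℝ) :
    HasDerivAt (fun u => Wm t u y)
      ((4 * Real.pi * t) ^ (-(1/2) : ℝ) *
        (Real.exp (-(x - y) ^ 2 / (4 * t)) * (-(2 * (x - y)) / (4 * t)) +
          Real.exp (-(x + y) ^ 2 / (4 * t)) * (-(2 * (x + y)) / (4 * t)))) x := by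
  have h1 : HasDerivAt (fun u : ℝ => -(u - y) ^ 2 / (4 * t)) (-(2 * (x - y)) / (4 * t)) x := by
    simpa using ((((hasDerivAt_id x).sub_const y).pow 2).neg).div_const (4 * t)
  have h2 : HasDerivAt (fun u : ℝ => -(u + y) ^ 2 / (4 * t)) (-(2 * (x + y)) / (4 * t)) x := by
    simpa using ((((hasDerivAt_id x).add_const y).pow 2).neg).div_const (4 * t)
  exact (h1.exp.add h2.exp).const_mul _

theorem rieszHalf_integrand_eq {t : ℝ} (ht : 0 < t) (x y : ℝ) :
    (deriv (fun u => Wm t u y) x - x⁻¹ * Wm t x y + x⁻¹ * Wm0 t y) * t ^ (-(1/2) : ℝ) =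
      (4 * Real.pi) ^ (-(1/2) : ℝ) *
        ((-(x - y) / 2 * ((t ^ 2)⁻¹ * Real.exp (-((x - y) ^ 2 / 4) / t)) +
          -(x + y) / 2 * ((t ^ 2)⁻¹ * Real.exp (-((x + y) ^ 2 / 4) / t))) +
        (x⁻¹ * (t⁻¹ * (Real.exp (-(y ^ 2 / 4) / t) - Real.exp (-((x - y) ^ 2 / 4) / t))) +
          x⁻¹ * (t⁻¹ * (Real.exp (-(y ^ 2 / 4) / t) - Real.exp (-((x + y) ^ 2 / 4) / t))))) := by
  have hexp (a : ℝ) : -a ^ 2 / (4 * t) = -(a ^ 2 / 4) / t := by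
    field_simp
  have hpow : t ^ (-(1/2) : ℝ) * t ^ (-(1/2) : ℝ) = t⁻¹ := by
    rw [← Real.rpow_add ht, ← Real.rpow_neg_one]
    norm_num
  rw [(hasDerivAt_Wm t x y).deriv]
  simp only [Wm, Wm0, hexp]
  rw [Real.mul_rpow (by positivity) ht.le]
  generalize Real.exp (-(y ^ 2 / 4) / t) = e₀
  generalize Real.exp (-((x - y) ^ 2 / 4) / t) = e₁
  generalize Real.exp (-((x + y) ^ 2 / 4) / t) = e₂
  generalize (4 * Real.pi) ^ (-(1/2) : ℝ) = k
  rw [show (t ^ 2)⁻¹ = t⁻¹ * t⁻¹ by rw [sq, mul_inv], ← hpow, div_eq_mul_inv _ (4 * t),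
    div_eq_mul_inv _ (4 * t), mul_inv, ← hpow]
  ring

theorem stmt16 (x y : ℝ) (hx : 0 < x) (hy : 0 < y) (hxy : x ≠ y) :
    RieszHalf x y =
      (1 / (Real.pi * x * y)) *
        (1 / (y - x) - 1 / (y + x) - (1 / x) * Real.log (y ^ 2 / (|x - y| * (x + y)))) := by
  have hxy' : x - y ≠ 0 := sub_ne_zero.2 hxy
  have hyx : y - x ≠ 0 := sub_ne_zero.2 hxy.symm
  have hs : x + y ≠ 0 := (add_pos hx hy).ne'
  have hc₀ : 0 < y ^ 2 / 4 := by positivity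
  have hc₁ : 0 < (x - y) ^ 2 / 4 := by positivity
  have hc₂ : 0 < (x + y) ^ 2 / 4 := by positivity
  have hi₁ := (integrableOn_exp_neg_div_div_sq hc₁).const_mul (-(x - y) / 2)
  have hi₂ := (integrableOn_exp_neg_div_div_sq hc₂).const_mul (-(x + y) / 2)
  have hi₃ := (integrableOn_inv_mul_exp_sub_exp hc₀ hc₁).const_mul x⁻¹
  have hi₄ := (integrableOn_inv_mul_exp_sub_exp hc₀ hc₂).const_mul x⁻¹
  have hpi : Real.pi ^ (-(1/2) : ℝ) * (4 * Real.pi) ^ (-(1/2) : ℝ) = (2 * Real.pi)⁻¹ := by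
    have h4 : (4 : ℝ) ^ (-(1/2) : ℝ) = 2⁻¹ := by
      rw [show (4 : ℝ) = 2 ^ (2 : ℝ) by norm_num, ← Real.rpow_mul (by norm_num),
        ← Real.rpow_neg_one]
      norm_num
    rw [Real.mul_rpow (by norm_num) Real.pi_pos.le, mul_left_comm, ← Real.rpow_add Real.pi_pos,
      h4, mul_inv, ← Real.rpow_neg_one Real.pi]
    norm_num
  have hlog : Real.log ((x - y) ^ 2 / 4 / (y ^ 2 / 4)) + Real.log ((x + y) ^ 2 / 4 / (y ^ 2 / 4)) =
      -(2 * Real.log (y ^ 2 / (|x - y| * (x + y)))) := by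
    have hsq := Real.log_pow (y ^ 2 / (|x - y| * (x + y))) 2
    rw [Nat.cast_two] at hsq
    rw [← Real.log_mul (by positivity) (by positivity), ← hsq, ← Real.log_inv]
    congr 1
    rw [div_pow, inv_div, mul_pow, sq_abs]
    field_simp
  have hadd := integral_add (hi₁.add hi₂) (hi₃.add hi₄)
  simp only [Pi.add_apply] at hadd
  rw [RieszHalf, setIntegral_congr_fun measurableSet_Ioi
    (fun t ht => rieszHalf_integrand_eq ht x y), integral_const_mul,
    hadd, integral_add hi₁ hi₂, integral_add hi₃ hi₄]
  simp only [integral_const_mul]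
  rw [integral_exp_neg_div_div_sq hc₁, integral_exp_neg_div_div_sq hc₂,
    integral_inv_mul_exp_sub_exp hc₀ hc₁, integral_inv_mul_exp_sub_exp hc₀ hc₂, ← mul_add, hlog,
    mul_assoc, ← mul_assoc (Real.pi ^ (-(1/2) : ℝ)), hpi]
  generalize Real.log (y ^ 2 / (|x - y| * (x + y))) = l
  have h₁ : -(x - y) / 2 * ((x - y) ^ 2 / 4)⁻¹ = 2 * (1 / (y - x)) := by
    rw [← neg_sub y x]
    field_simp
    ring
  have h₂ : -(x + y) / 2 * ((x + y) ^ 2 / 4)⁻¹ = -(2 * (1 / (y + x))) := by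
    rw [add_comm y x]
    field_simp
    ring
  rw [h₁, h₂]
  generalize 1 / (y - x) = p
  generalize 1 / (y + x) = q
  have hpi0 := Real.pi_ne_zero
  field_simp
  ring

end
end
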